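/- There exists ε₀ > 0 (together with C₁ > 0 and M > 1 as in the bootstrap lemma) such that for any 0 ≤ ε ≤ ε₀ and any B₀ T²-symmetric Einstein flow satisfying at some time s₀ > 0 the smallness conditions |A| < 1, inf_{S¹} ρ(·, s₀) > 0, |c(s₀)| < ε, |d(s₀)| < ε, |ΠE/H − 1|(s₀) < 1, (1/2)ε^{−1} < e^{s₀} < 2ε^{−1}, e^{s₀}H(s₀) + C₁ε^{1/2} < M ε e^{s₀}, and 0 < 1/M < e^{s₀}H(s₀) − C₁ε^{1/2}, there exist C_∞ > 0 and a function ρ_∞ : S¹ → ℝ such that for all τ ∈ [s₀, ∞): |(c,d)|(τ) ≲ e^{−τ/4}; |e^{τ}H(τ) − C_∞²| ≲ e^{−τ/4}; |e^{−τ/2}Π(τ) − (2/√10)C_∞| ≲ e^{−τ/4}; |e^{−5τ/2}Y(τ) − (1/√10)C_∞| ≲ e^{−τ/4}; |e^{3τ/2}E(τ) − (√10/2)C_∞| ≲ e^{−τ/4}; sup_{θ∈S¹}|⟨l⟩(τ) − l(τ,θ)| ≲ e^{−τ/2}; sup_{θ∈S¹}|e^{l(τ,θ)} − 1/2| ≲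 e^{−τ/4}; sup_{θ∈S¹}( |⟨V⟩(τ) − V(τ,θ)| + |e^{V(τ,θ)−τ}(⟨Q⟩(τ) − Q(τ,θ))| ) ≲ e^{−τ/2}; and sup_{θ∈S¹}|Π(τ)^{−1}e^{ρ(τ,θ)} − e^{ρ_∞(θ)}| ≲ e^{−τ/2}. -/

import Mathlib

noncomputable section

open Real MeasureTheory intervalIntegral

/-- The θ-mean of a function on the circle of circumference 1 (total measure 1). -/
def circleMean (f : ℝ → ℝ) : ℝ := ∫ θ in (0:ℝ)..1, f θ

/-- The smooth, θ-periodic fields `V, Q, ρ, l` of a T²-symmetric spacetime in areal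
coordinates; first argument is `τ`, second is `θ`. -/
structure T2Flow where
  V : ℝ → ℝ → ℝ
  Q : ℝ → ℝ → ℝ
  ρ : ℝ → ℝ → ℝ
  l : ℝ → ℝ → ℝ
  smooth_V : ContDiff ℝ (⊤ : ℕ∞) (Function.uncurry V)
  smooth_Q : ContDiff ℝ (⊤ : ℕ∞) (Function.uncurry Q)
  smooth_ρ : ContDiff ℝ (⊤ : ℕ∞) (Function.uncurry ρ)
  smooth_l : ContDiff ℝ (⊤ : ℕ∞) (Function.uncurry l)
  periodic_V : ∀ τ, Function.Periodic (V τ) 1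
  periodic_Q : ∀ τ, Function.Periodic (Q τ) 1
  periodic_ρ : ∀ τ, Function.Periodic (ρ τ) 1
  periodic_l : ∀ τ, Function.Periodic (l τ) 1

namespace T2Flow

/-- `V_τ`. -/
def Vτ (F : T2Flow) (τ θ : ℝ) : ℝ := deriv (fun s => F.V s θ) τ
/-- `V_θ`. -/
def Vθ (F : T2Flow) (τ θ : ℝ) : ℝ := deriv (fun x => F.V τ x) θ
/-- `Q_τ`. -/
def Qτ (F : T2Flow) (τ θ : ℝ) : ℝ := deriv (fun s => F.Q s θ) τ
/-- `Q_θ`. -/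
def Qθ (F : T2Flow) (τ θ : ℝ) : ℝ := deriv (fun x => F.Q τ x) θ
/-- `ρ_τ`. -/
def ρτ (F : T2Flow) (τ θ : ℝ) : ℝ := deriv (fun s => F.ρ s θ) τ
/-- `l_τ`. -/
def lτ (F : T2Flow) (τ θ : ℝ) : ℝ := deriv (fun s => F.l s θ) τ
/-- `l_θ`. -/
def lθ (F : T2Flow) (τ θ : ℝ) : ℝ := deriv (fun x => F.l τ x) θ

/-- The energy density
`J = (1/2)[V_τ² + e^{2(τ−ρ)}V_θ² + e^{2(V−τ)}(Q_τ² + e^{2(τ−ρ)}Q_θ²)]`. -/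
def J (F : T2Flow) (τ θ : ℝ) : ℝ :=
  (1/2) * (F.Vτ τ θ ^ 2 + exp (2*(τ - F.ρ τ θ)) * F.Vθ τ θ ^ 2
    + exp (2*(F.V τ θ - τ)) * (F.Qτ τ θ ^ 2 + exp (2*(τ - F.ρ τ θ)) * F.Qθ τ θ ^ 2))

/-- The T²-symmetric vacuum Einstein evolution equations together with the
momentum constraint. -/
def IsEinsteinFlow (F : T2Flow) : Prop :=
  (∀ τ θ : ℝ, deriv (fun s => exp (F.ρ s θ) * F.Vτ s θ) τ
      = deriv (fun x => exp (2*τ - F.ρ τ x) * F.Vθ τ x) θ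
        + exp (2*(F.V τ θ - τ) + F.ρ τ θ)
          * (F.Qτ τ θ ^ 2 - exp (2*(τ - F.ρ τ θ)) * F.Qθ τ θ ^ 2)) ∧
  (∀ τ θ : ℝ, deriv (fun s => exp (F.ρ s θ + 2*(F.V s θ - s)) * F.Qτ s θ) τ
      = deriv (fun x => exp (-F.ρ τ x + 2*F.V τ x) * F.Qθ τ x) θ) ∧
  (∀ τ θ : ℝ, F.lτ τ θ + F.ρτ τ θ + 2 = F.J τ θ) ∧
  (∀ τ θ : ℝ, F.ρτ τ θ = exp (F.l τ θ)) ∧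
  (∀ τ θ : ℝ, F.lθ τ θ = F.Vθ τ θ * F.Vτ τ θ
      + exp (2*(F.V τ θ - τ)) * F.Qθ τ θ * F.Qτ τ θ)

/-- The conserved quantity `A = ∫ e^ρ (V_τ − e^{2(V−τ)} Q_τ Q) dθ`. -/
def A (F : T2Flow) (τ : ℝ) : ℝ :=
  ∫ θ in (0:ℝ)..1,
    exp (F.ρ τ θ) * (F.Vτ τ θ - exp (2*(F.V τ θ - τ)) * F.Qτ τ θ * F.Q τ θ)

/-- The conserved quantity `B = ∫ e^{ρ+2(V−τ)} Q_τ dθ`. -/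
def B (F : T2Flow) (τ : ℝ) : ℝ :=
  ∫ θ in (0:ℝ)..1, exp (F.ρ τ θ + 2*(F.V τ θ - τ)) * F.Qτ τ θ

/-- The energy `E = ∫ e^{ρ−2τ} J dθ`. -/
def E (F : T2Flow) (τ : ℝ) : ℝ := ∫ θ in (0:ℝ)..1, exp (F.ρ τ θ - 2*τ) * F.J τ θ

/-- The `S¹`-volume `Π = ⟨e^ρ⟩`. -/
def Pi (F : T2Flow) (τ : ℝ) : ℝ := ∫ θ in (0:ℝ)..1, exp (F.ρ τ θ)

/-- The correction `Λ = (1/2) e^{−2τ} ∫ V_τ (V − ⟨V⟩ − 1) e^ρ dθ`. -/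
def Λ (F : T2Flow) (τ : ℝ) : ℝ :=
  (1/2) * exp (-2*τ) *
    ∫ θ in (0:ℝ)..1, F.Vτ τ θ * (F.V τ θ - circleMean (F.V τ) - 1) * exp (F.ρ τ θ)

/-- The corrected, normalized energy `H = Π (E + Λ)`. -/
def H (F : T2Flow) (τ : ℝ) : ℝ := F.Pi τ * (F.E τ + F.Λ τ)

/-- The twist potential `Y = ⟨e^{l+ρ+2τ}⟩`. -/
def Y (F : T2Flow) (τ : ℝ) : ℝ := ∫ θ in (0:ℝ)..1, exp (F.l τ θ + F.ρ τ θ + 2*τ)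

/-- The error term `Ω = ⟨e^{l+ρ+2τ} J⟩ − e^{2τ} E Y Π⁻¹`. -/
def Ω (F : T2Flow) (τ : ℝ) : ℝ :=
  (∫ θ in (0:ℝ)..1, exp (F.l τ θ + F.ρ τ θ + 2*τ) * F.J τ θ)
    - exp (2*τ) * F.E τ * F.Y τ / F.Pi τ

end T2Flow

namespace T2Flow

/-- The normalized quantity `c = Π/(e^τ √H) − 2/√10`. -/
def c (F : T2Flow) (τ : ℝ) : ℝ :=
  F.Pi τ / (Real.exp τ * Real.sqrt (F.H τ)) - 2 / Real.sqrt 10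

/-- The normalized quantity `d = Y/(e^{3τ} √H) − 1/√10`. -/
def d (F : T2Flow) (τ : ℝ) : ℝ :=
  F.Y τ / (Real.exp (3*τ) * Real.sqrt (F.H τ)) - 1 / Real.sqrt 10

end T2Flow

/-- The quadratic nonlinearity `f(c,d) = ((10c − 10d + 3√10)/4)c² − √10 c d`. -/
def fquad (c d : ℝ) : ℝ :=
  ((10*c - 10*d + 3*Real.sqrt 10) / 4) * c ^ 2 - Real.sqrt 10 * (c * d)

namespace T2Flow

/-- The error vector `Ω̃` of the linearized `(c,d)` system. -/
def Ωtilde (F : T2Flow) (τ : ℝ) : ℝ × ℝ :=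
  (-(1/2) * deriv (fun s => Real.log (Real.exp s * F.H s)) τ * (2 / Real.sqrt 10),
   -(1/2) * deriv (fun s => Real.log (Real.exp s * F.H s)) τ * (1 / Real.sqrt 10)
     + fquad (F.d τ) (F.c τ) / (F.c τ + 2 / Real.sqrt 10) ^ 2
     + (F.Pi τ * F.E τ / F.H τ - 1) * (F.d τ + 1 / Real.sqrt 10)
         / (F.c τ + 2 / Real.sqrt 10) ^ 2
     + F.Ω τ / (Real.exp (3*τ) * Real.sqrt (F.H τ)))

end T2Flow

/-- Smoothness of a field in the variables `(τ, θ)`. -/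
def SmoothField (f : ℝ → ℝ → ℝ) : Prop := ContDiff ℝ (⊤ : ℕ∞) (Function.uncurry f)

/-- The partial derivative in the first variable. -/
def pT (f : ℝ → ℝ → ℝ) (τ θ : ℝ) : ℝ := deriv (fun s => f s θ) τ

/-- The partial derivative in the second variable. -/
def pX (f : ℝ → ℝ → ℝ) (τ θ : ℝ) : ℝ := deriv (fun x => f τ x) θ

namespace SmoothField

variable {f g : ℝ → ℝ → ℝ}

theorem mul (hf : SmoothField f) (hg : SmoothField g) :
    SmoothField (fun τ θ => f τ θ * g τ θ) := ContDiff.mul hf hg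

theorem add (hf : SmoothField f) (hg : SmoothField g) :
    SmoothField (fun τ θ => f τ θ + g τ θ) := ContDiff.add hf hg

theorem sub (hf : SmoothField f) (hg : SmoothField g) :
    SmoothField (fun τ θ => f τ θ - g τ θ) := ContDiff.sub hf hg

theorem neg (hf : SmoothField f) : SmoothField (fun τ θ => - f τ θ) := ContDiff.neg hf

theorem exp (hf : SmoothField f) : SmoothField (fun τ θ => Real.exp (f τ θ)) :=
  ContDiff.exp hf

theorem pow (hf : SmoothField f) (n : ℕ) : SmoothField (fun τ θ => f τ θ ^ n) :=
  ContDiff.pow hf n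

theorem const (c : ℝ) : SmoothField (fun _ _ => c) := contDiff_const

theorem time : SmoothField (fun τ _ => τ) := contDiff_fst

theorem const_mul (c : ℝ) (hf : SmoothField f) : SmoothField (fun τ θ => c * f τ θ) :=
  (const c).mul hf

theorem continuous_uncurry (hf : SmoothField f) : Continuous (Function.uncurry f) :=
  ContDiff.continuous hf

theorem continuous_right (hf : SmoothField f) (τ : ℝ) : Continuous (f τ) :=
  hf.continuous_uncurry.comp (by fun_prop : Continuous fun θ : ℝ => (τ, θ))

theorem intervalIntegrable (hf : SmoothField f) (τ a b : ℝ) :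
    IntervalIntegrable (f τ) volume a b := (hf.continuous_right τ).intervalIntegrable a b

theorem hasFDerivAt (hf : SmoothField f) (p : ℝ × ℝ) :
    HasFDerivAt (Function.uncurry f) (fderiv ℝ (Function.uncurry f) p) p :=
  ((ContDiff.differentiable hf (by simp)) p).hasFDerivAt

theorem hasDerivAt_fst (hf : SmoothField f) (τ θ : ℝ) :
    HasDerivAt (fun s => f s θ) (fderiv ℝ (Function.uncurry f) (τ, θ) (1, 0)) τ := by
  have h1 : HasDerivAt (fun s : ℝ => (s, θ)) ((1 : ℝ), (0 : ℝ)) τ :=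
    (hasDerivAt_id τ).prodMk (hasDerivAt_const τ θ)
  exact (hf.hasFDerivAt (τ, θ)).comp_hasDerivAt τ h1

theorem hasDerivAt_snd (hf : SmoothField f) (τ θ : ℝ) :
    HasDerivAt (fun x => f τ x) (fderiv ℝ (Function.uncurry f) (τ, θ) (0, 1)) θ := by
  have h1 : HasDerivAt (fun x : ℝ => (τ, x)) ((0 : ℝ), (1 : ℝ)) θ :=
    (hasDerivAt_const θ τ).prodMk (hasDerivAt_id θ)
  exact (hf.hasFDerivAt (τ, θ)).comp_hasDerivAt θ h1

theorem pT_eq (hf : SmoothField f) (τ θ : ℝ) :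
    pT f τ θ = fderiv ℝ (Function.uncurry f) (τ, θ) (1, 0) := (hf.hasDerivAt_fst τ θ).deriv

theorem pX_eq (hf : SmoothField f) (τ θ : ℝ) :
    pX f τ θ = fderiv ℝ (Function.uncurry f) (τ, θ) (0, 1) := (hf.hasDerivAt_snd τ θ).deriv

theorem hasDerivAt_pT (hf : SmoothField f) (τ θ : ℝ) :
    HasDerivAt (fun s => f s θ) (pT f τ θ) τ := by
  rw [hf.pT_eq]; exact hf.hasDerivAt_fst τ θ

theorem hasDerivAt_pX (hf : SmoothField f) (τ θ : ℝ) :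
    HasDerivAt (fun x => f τ x) (pX f τ θ) θ := by
  rw [hf.pX_eq]; exact hf.hasDerivAt_snd τ θ

theorem fderiv_apply (hf : SmoothField f) (v : ℝ × ℝ) :
    ContDiff ℝ (⊤ : ℕ∞) (fun p => fderiv ℝ (Function.uncurry f) p v) :=
  (ContDiff.fderiv_right hf (by simp)).clm_apply contDiff_const

theorem pT (hf : SmoothField f) : SmoothField (pT f) := by
  have : Function.uncurry (_root_.pT f)
      = fun p => fderiv ℝ (Function.uncurry f) p (1, 0) := by
    ext ⟨τ, θ⟩; exact hf.pT_eq τ θ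
  rw [SmoothField, this]
  exact hf.fderiv_apply _

theorem pX (hf : SmoothField f) : SmoothField (pX f) := by
  have : Function.uncurry (_root_.pX f)
      = fun p => fderiv ℝ (Function.uncurry f) p (0, 1) := by
    ext ⟨τ, θ⟩; exact hf.pX_eq τ θ
  rw [SmoothField, this]
  exact hf.fderiv_apply _

theorem pT_pX_comm (hf : SmoothField f) (τ θ : ℝ) :
    _root_.pT (_root_.pX f) τ θ = _root_.pX (_root_.pT f) τ θ := by
  have e1 : Function.uncurry (_root_.pX f)
      = fun p => fderiv ℝ (Function.uncurry f) p (0, 1) := by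
    ext ⟨τ, θ⟩; exact hf.pX_eq τ θ
  have e2 : Function.uncurry (_root_.pT f)
      = fun p => fderiv ℝ (Function.uncurry f) p (1, 0) := by
    ext ⟨τ, θ⟩; exact hf.pT_eq τ θ
  have hd : DifferentiableAt ℝ (fderiv ℝ (Function.uncurry f)) (τ, θ) :=
    (ContDiff.differentiable (n := (⊤ : ℕ∞)) (ContDiff.fderiv_right hf (by simp)) (by simp)) _
  have hs := (ContDiff.contDiffAt (x := (τ, θ)) hf).isSymmSndFDerivAt
    (by simpa using WithTop.coe_le_coe.2 (le_top : (2 : ℕ∞) ≤ ⊤))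
  rw [hf.pX.pT_eq, hf.pT.pX_eq, e1, e2]
  have key : ∀ v w : ℝ × ℝ, fderiv ℝ (fun p => fderiv ℝ (Function.uncurry f) p v) (τ, θ) w
      = fderiv ℝ (fderiv ℝ (Function.uncurry f)) (τ, θ) w v := by
    intro v w
    rw [fderiv_clm_apply hd (by fun_prop)]
    simp
  rw [key, key]
  exact hs _ _

theorem hasDerivAt_integral_pT (hf : SmoothField f) (τ : ℝ) :
    HasDerivAt (fun s => ∫ θ in (0:ℝ)..1, f s θ) (∫ θ in (0:ℝ)..1, _root_.pT f τ θ) τ := by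
  obtain ⟨C, hC⟩ := ((isCompact_Icc (a := τ - 1) (b := τ + 1)).prod
    (isCompact_Icc (a := (0:ℝ)) (b := 1))).exists_bound_of_continuousOn
    hf.pT.continuous_uncurry.continuousOn
  refine (hasDerivAt_integral_of_dominated_loc_of_deriv_le
    (F := f) (F' := _root_.pT f) (bound := fun _ => C)
    (Icc_mem_nhds (by linarith : τ - 1 < τ) (by linarith : τ < τ + 1))
    (Filter.Eventually.of_forall fun s => (hf.continuous_right s).aestronglyMeasurable)
    (hf.intervalIntegrable τ 0 1) (hf.pT.continuous_right τ).aestronglyMeasurable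
    (Filter.Eventually.of_forall fun t ht s hs => ?_) intervalIntegrable_const
    (Filter.Eventually.of_forall fun t _ s _ => hf.hasDerivAt_pT s t)).2
  rw [Set.uIoc_of_le zero_le_one] at ht
  exact hC (s, t) ⟨hs, ⟨ht.1.le, ht.2⟩⟩

/-- Integrating a local balance law over the circle: the flux drops out by periodicity. -/
theorem hasDerivAt_integral_of_balance (hf : SmoothField f) {τ : ℝ} {s φ φ' : ℝ → ℝ}
    (hs : Continuous s) (hφ : ∀ θ, HasDerivAt φ (φ' θ) θ) (hφ' : Continuous φ')
    (hper : Function.Periodic φ 1) (h : ∀ θ, _root_.pT f τ θ = s θ + φ' θ) :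
    HasDerivAt (fun s => ∫ θ in (0:ℝ)..1, f s θ) (∫ θ in (0:ℝ)..1, s θ) τ := by
  have h0 : ∫ θ in (0:ℝ)..1, φ' θ = 0 := by
    rw [integral_eq_sub_of_hasDerivAt (fun θ _ => hφ θ) (hφ'.intervalIntegrable 0 1)]
    have := hper 0
    simp at this
    simp [this]
  have h1 := hf.hasDerivAt_integral_pT τ
  simp_rw [h] at h1
  rwa [integral_add (hs.intervalIntegrable 0 1) (hφ'.intervalIntegrable 0 1), h0, add_zero] at h1

end SmoothField

/-- A Cauchy–Schwarz inequality in the form `(∫ h)² ≤ (∫ a)(∫ b)` whenever `h² ≤ a b`. -/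
theorem sq_integral_le_mul {a b h : ℝ → ℝ} (ha : Continuous a) (hb : Continuous b)
    (hh : Continuous h) (ha0 : ∀ θ, 0 ≤ a θ) (hb0 : ∀ θ, 0 ≤ b θ)
    (hab : ∀ θ, h θ ^ 2 ≤ a θ * b θ) :
    (∫ θ in (0:ℝ)..1, h θ) ^ 2 ≤ (∫ θ in (0:ℝ)..1, a θ) * ∫ θ in (0:ℝ)..1, b θ := by
  have key : ∀ t : ℝ, 0 ≤ (∫ θ in (0:ℝ)..1, b θ) * (t * t)
      + (-2 * ∫ θ in (0:ℝ)..1, h θ) * t + ∫ θ in (0:ℝ)..1, a θ := by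
    intro t
    have h1 : ∫ θ in (0:ℝ)..1, (b θ * (t * t) + (-2 * h θ) * t + a θ)
        = (∫ θ in (0:ℝ)..1, b θ) * (t * t)
      + (-2 * ∫ θ in (0:ℝ)..1, h θ) * t + ∫ θ in (0:ℝ)..1, a θ := by
      rw [integral_add (Continuous.intervalIntegrable (by fun_prop) _ _)
        (Continuous.intervalIntegrable (by fun_prop) _ _),
        integral_add (Continuous.intervalIntegrable (by fun_prop) _ _)
        (Continuous.intervalIntegrable (by fun_prop) _ _),
        intervalIntegral.integral_mul_const, intervalIntegral.integral_mul_const,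
        intervalIntegral.integral_const_mul]
    rw [← h1]
    refine integral_nonneg zero_le_one fun θ _ => ?_
    have h2 := ha0 θ
    have h3 := hb0 θ
    have h4 := hab θ
    have h5 : (2 * h θ * t) ^ 2 ≤ (b θ * (t * t) + a θ) ^ 2 := by
      nlinarith [sq_nonneg (b θ * (t * t) - a θ), mul_le_mul_of_nonneg_right h4 (sq_nonneg t)]
    have h6 : 0 ≤ b θ * (t * t) := mul_nonneg h3 (mul_self_nonneg t)
    have h7 := abs_le_of_sq_le_sq h5 (by linarith)
    linarith [le_abs_self (2 * h θ * t)]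
  have := discrim_le_zero key
  rw [discrim] at this
  linarith

theorem exists_mem_Icc_of_periodic {f g : ℝ → ℝ} (hf : Function.Periodic f 1)
    (hg : Function.Periodic g 1) (θ : ℝ) :
    ∃ θ' ∈ Set.Icc (0:ℝ) 1, f θ' = f θ ∧ g θ' = g θ := by
  refine ⟨Int.fract θ, ⟨Int.fract_nonneg θ, (Int.fract_lt_one θ).le⟩, ?_, ?_⟩
  · have := hf.sub_int_mul_eq ⌊θ⌋ (x := θ)
    rwa [mul_one] at this
  · have := hg.sub_int_mul_eq ⌊θ⌋ (x := θ)
    rwa [mul_one] at this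

/-- The oscillation of a periodic function is at most the integral of its derivative. -/
theorem abs_sub_le_integral_abs {f f' : ℝ → ℝ} (hf : ∀ θ, HasDerivAt f (f' θ) θ)
    (hf' : Continuous f') (hper : Function.Periodic f 1) (x y : ℝ) :
    |f x - f y| ≤ ∫ θ in (0:ℝ)..1, |f' θ| := by
  obtain ⟨x', hx', ex, -⟩ := exists_mem_Icc_of_periodic hper hper x
  obtain ⟨y', hy', ey, -⟩ := exists_mem_Icc_of_periodic hper hper y
  rw [← ex, ← ey, ← integral_eq_sub_of_hasDerivAt (fun θ _ => hf θ) (hf'.intervalIntegrable y' x')]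
  refine (norm_integral_le_integral_norm_uIoc (f := f')).trans ?_
  simp only [Real.norm_eq_abs]
  rw [intervalIntegral.integral_of_le zero_le_one]
  refine setIntegral_mono_set ?_ (Filter.Eventually.of_forall fun _ => abs_nonneg _) ?_
  · exact (hf'.abs.integrableOn_Icc (a := 0) (b := 1)).mono_set Set.Ioc_subset_Icc_self
  · refine Filter.Eventually.of_forall fun z hz => ?_
    rcases Set.mem_uIoc.1 hz with h | h
    · exact ⟨hy'.1.trans_lt h.1, h.2.trans hx'.2⟩
    · exact ⟨hx'.1.trans_lt h.1, h.2.trans hy'.2⟩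

/-- A pointwise bound on differences passes to the difference from the mean. -/
theorem abs_sub_circleMean_le {f : ℝ → ℝ} (hf : Continuous f) {x w : ℝ}
    (h : ∀ y, |f x - f y| ≤ w) : |f x - circleMean f| ≤ w := by
  have e : f x - circleMean f = ∫ y in (0:ℝ)..1, (f x - f y) := by
    rw [integral_sub intervalIntegrable_const (hf.intervalIntegrable 0 1)]
    simp [circleMean]
  rw [e]
  have := norm_integral_le_of_norm_le_const (a := (0:ℝ)) (b := 1) (f := fun y => f x - f y)
    (C := w) (fun y _ => h y)
  simpa using this

theorem SmoothField.hasDerivAt_integral_of_balance' {f : ℝ → ℝ → ℝ} (hf : SmoothField f) {τ : ℝ}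
    {s φ φ' : ℝ → ℝ}
    (hs : Continuous s) (hφ : ∀ θ, HasDerivAt φ (φ' θ) θ) (hφ' : Continuous φ')
    (hper : Function.Periodic φ 1) (h : ∀ θ, HasDerivAt (fun t => f t θ) (s θ + φ' θ) τ) :
    HasDerivAt (fun s => ∫ θ in (0:ℝ)..1, f s θ) (∫ θ in (0:ℝ)..1, s θ) τ :=
  hf.hasDerivAt_integral_of_balance hs hφ hφ' hper fun θ => (h θ).deriv

theorem periodic_deriv {f : ℝ → ℝ} (hf : Function.Periodic f 1) :
    Function.Periodic (deriv f) 1 := by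
  intro x
  have : (fun y => f (y + 1)) = f := funext hf
  rw [← deriv_comp_add_const, this]

namespace T2Flow

variable (F : T2Flow)

theorem sV : SmoothField F.V := F.smooth_V
theorem sQ : SmoothField F.Q := F.smooth_Q
theorem sρ : SmoothField F.ρ := F.smooth_ρ
theorem sl : SmoothField F.l := F.smooth_l
theorem sVτ : SmoothField F.Vτ := F.sV.pT
theorem sVθ : SmoothField F.Vθ := F.sV.pX
theorem sQτ : SmoothField F.Qτ := F.sQ.pT
theorem sQθ : SmoothField F.Qθ := F.sQ.pX

theorem per_Vθ (τ : ℝ) : Function.Periodic (F.Vθ τ) 1 := periodic_deriv (F.periodic_V τ)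
theorem per_Qθ (τ : ℝ) : Function.Periodic (F.Qθ τ) 1 := periodic_deriv (F.periodic_Q τ)

theorem per_Vτ (τ : ℝ) : Function.Periodic (F.Vτ τ) 1 := fun θ => by
  have : (fun s => F.V s (θ + 1)) = fun s => F.V s θ := funext fun s => F.periodic_V s θ
  simp only [Vτ, this]

theorem per_Qτ (τ : ℝ) : Function.Periodic (F.Qτ τ) 1 := fun θ => by
  have : (fun s => F.Q s (θ + 1)) = fun s => F.Q s θ := funext fun s => F.periodic_Q s θ
  simp only [Qτ, this]

/-- The coefficient of `V_θ²` in the energy. -/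
def coefVθ (τ θ : ℝ) : ℝ := exp (2*τ - F.ρ τ θ)
/-- The coefficient of `Q_τ²` in the energy. -/
def coefQτ (τ θ : ℝ) : ℝ := exp (F.ρ τ θ + 2*(F.V τ θ - τ))
/-- The coefficient of `Q_θ²` in the energy. -/
def coefQθ (τ θ : ℝ) : ℝ := exp (-F.ρ τ θ + 2*F.V τ θ)

theorem s_coefVθ : SmoothField F.coefVθ :=
  (((SmoothField.const 2).mul SmoothField.time).sub F.sρ).exp
theorem s_coefQτ : SmoothField F.coefQτ :=
  (F.sρ.add ((SmoothField.const 2).mul (F.sV.sub SmoothField.time))).exp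
theorem s_coefQθ : SmoothField F.coefQθ :=
  (F.sρ.neg.add ((SmoothField.const 2).mul F.sV)).exp

/-- The four components of twice the energy density `e^ρ J`. -/
def T₁ (τ θ : ℝ) : ℝ := exp (F.ρ τ θ) * F.Vτ τ θ ^ 2
/-- See `T₁`. -/
def T₂ (τ θ : ℝ) : ℝ := F.coefVθ τ θ * F.Vθ τ θ ^ 2
/-- See `T₁`. -/
def T₃ (τ θ : ℝ) : ℝ := F.coefQτ τ θ * F.Qτ τ θ ^ 2
/-- See `T₁`. -/
def T₄ (τ θ : ℝ) : ℝ := F.coefQθ τ θ * F.Qθ τ θ ^ 2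

theorem s_T₁ : SmoothField F.T₁ := F.sρ.exp.mul (F.sVτ.pow 2)
theorem s_T₂ : SmoothField F.T₂ := F.s_coefVθ.mul (F.sVθ.pow 2)
theorem s_T₃ : SmoothField F.T₃ := F.s_coefQτ.mul (F.sQτ.pow 2)
theorem s_T₄ : SmoothField F.T₄ := F.s_coefQθ.mul (F.sQθ.pow 2)

theorem T₁_nonneg (τ θ : ℝ) : 0 ≤ F.T₁ τ θ := by unfold T₁; positivity
theorem T₂_nonneg (τ θ : ℝ) : 0 ≤ F.T₂ τ θ := by unfold T₂ coefVθ; positivity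
theorem T₃_nonneg (τ θ : ℝ) : 0 ≤ F.T₃ τ θ := by unfold T₃ coefQτ; positivity
theorem T₄_nonneg (τ θ : ℝ) : 0 ≤ F.T₄ τ θ := by unfold T₄ coefQθ; positivity

/-- The energy density `e^ρ J`. -/
def kin (τ θ : ℝ) : ℝ := 1/2 * (F.T₁ τ θ + F.T₂ τ θ + F.T₃ τ θ + F.T₄ τ θ)

theorem s_kin : SmoothField F.kin :=
  (SmoothField.const (1/2)).mul (((F.s_T₁.add F.s_T₂).add F.s_T₃).add F.s_T₄)

theorem kin_eq (τ θ : ℝ) : exp (F.ρ τ θ) * F.J τ θ = F.kin τ θ := by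
  have e1 : exp (F.ρ τ θ) * exp (2*(τ - F.ρ τ θ)) = F.coefVθ τ θ := by
    rw [coefVθ, ← exp_add]; ring_nf
  have e2 : exp (F.ρ τ θ) * exp (2*(F.V τ θ - τ)) = F.coefQτ τ θ := by
    rw [coefQτ, ← exp_add]
  have e3 : F.coefQτ τ θ * exp (2*(τ - F.ρ τ θ)) = F.coefQθ τ θ := by
    rw [coefQτ, coefQθ, ← exp_add]; ring_nf
  rw [J, kin, T₁, T₂, T₃, T₄, ← e3, ← e1, ← e2]
  ring

theorem kin_nonneg (τ θ : ℝ) : 0 ≤ F.kin τ θ := by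
  have := F.T₁_nonneg τ θ
  have := F.T₂_nonneg τ θ
  have := F.T₃_nonneg τ θ
  have := F.T₄_nonneg τ θ
  unfold kin; linarith

variable {F}

theorem IsEinsteinFlow.ρτ_eq (h : F.IsEinsteinFlow) (τ θ : ℝ) : F.ρτ τ θ = exp (F.l τ θ) :=
  h.2.2.2.1 τ θ

theorem IsEinsteinFlow.hasDerivAt_ρ (h : F.IsEinsteinFlow) (τ θ : ℝ) :
    HasDerivAt (fun s => F.ρ s θ) (exp (F.l τ θ)) τ := by
  rw [← h.ρτ_eq]; exact F.sρ.hasDerivAt_pT τ θ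

theorem IsEinsteinFlow.hasDerivAt_l (h : F.IsEinsteinFlow) (τ θ : ℝ) :
    HasDerivAt (fun s => F.l s θ) (F.J τ θ - 2 - exp (F.l τ θ)) τ := by
  have h1 := h.2.2.1 τ θ
  rw [h.ρτ_eq] at h1
  have : F.J τ θ - 2 - exp (F.l τ θ) = F.lτ τ θ := by linarith
  rw [this]; exact F.sl.hasDerivAt_pT τ θ

theorem IsEinsteinFlow.hasDerivAt_coefVθ (h : F.IsEinsteinFlow) (τ θ : ℝ) :
    HasDerivAt (fun s => F.coefVθ s θ) (F.coefVθ τ θ * (2 - exp (F.l τ θ))) τ := by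
  have := (((hasDerivAt_id τ).const_mul 2).sub (h.hasDerivAt_ρ τ θ)).exp
  simpa [coefVθ] using this

theorem IsEinsteinFlow.hasDerivAt_coefQτ (h : F.IsEinsteinFlow) (τ θ : ℝ) :
    HasDerivAt (fun s => F.coefQτ s θ)
      (F.coefQτ τ θ * (exp (F.l τ θ) + 2 * (F.Vτ τ θ - 1))) τ :=
  ((h.hasDerivAt_ρ τ θ).add
    (((F.sV.hasDerivAt_pT τ θ).sub (hasDerivAt_id τ)).const_mul 2)).exp

theorem IsEinsteinFlow.hasDerivAt_coefQθ (h : F.IsEinsteinFlow) (τ θ : ℝ) :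
    HasDerivAt (fun s => F.coefQθ s θ)
      (F.coefQθ τ θ * (-exp (F.l τ θ) + 2 * F.Vτ τ θ)) τ :=
  ((h.hasDerivAt_ρ τ θ).neg.add ((F.sV.hasDerivAt_pT τ θ).const_mul 2)).exp

variable (F)

theorem hasDerivAt_coefVθ_snd (τ θ : ℝ) :
    HasDerivAt (fun x => F.coefVθ τ x) (F.coefVθ τ θ * (- pX F.ρ τ θ)) θ := by
  have := ((F.sρ.hasDerivAt_pX τ θ).const_sub (2*τ)).exp
  exact this

theorem hasDerivAt_coefQθ_snd (τ θ : ℝ) :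
    HasDerivAt (fun x => F.coefQθ τ x) (F.coefQθ τ θ * (- pX F.ρ τ θ + 2 * F.Vθ τ θ)) θ :=
  ((F.sρ.hasDerivAt_pX τ θ).neg.add ((F.sV.hasDerivAt_pX τ θ).const_mul 2)).exp

variable {F}

/-- The equation for `V`, with the derivatives expanded. -/
theorem IsEinsteinFlow.wave_V (h : F.IsEinsteinFlow) (τ θ : ℝ) :
    exp (F.ρ τ θ) * exp (F.l τ θ) * F.Vτ τ θ + exp (F.ρ τ θ) * pT F.Vτ τ θ
      = F.coefVθ τ θ * (- pX F.ρ τ θ) * F.Vθ τ θ + F.coefVθ τ θ * pX F.Vθ τ θ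
        + F.T₃ τ θ - F.T₄ τ θ := by
  have h1 := h.1 τ θ
  have h0 := ((h.hasDerivAt_ρ τ θ).exp.mul (F.sVτ.hasDerivAt_pT τ θ)).deriv
  change deriv (fun s => exp (F.ρ s θ) * F.Vτ s θ) τ = _ at h0
  have h2 := ((F.hasDerivAt_coefVθ_snd τ θ).mul (F.sVθ.hasDerivAt_pX τ θ)).deriv
  have e2 : exp (2*(F.V τ θ - τ) + F.ρ τ θ) = F.coefQτ τ θ := by rw [coefQτ, add_comm]
  have e3 : F.coefQτ τ θ * exp (2*(τ - F.ρ τ θ)) = F.coefQθ τ θ := by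
    rw [coefQτ, coefQθ, ← exp_add]; ring_nf
  change deriv (fun x => exp (2*τ - F.ρ τ x) * F.Vθ τ x) θ = _ at h2
  rw [h0, h2, e2] at h1
  rw [T₃, T₄, ← e3]
  linear_combination h1

/-- The equation for `Q`, with the derivatives expanded. -/
theorem IsEinsteinFlow.wave_Q (h : F.IsEinsteinFlow) (τ θ : ℝ) :
    F.coefQτ τ θ * (exp (F.l τ θ) + 2 * (F.Vτ τ θ - 1)) * F.Qτ τ θ + F.coefQτ τ θ * pT F.Qτ τ θ
      = F.coefQθ τ θ * (- pX F.ρ τ θ + 2 * F.Vθ τ θ) * F.Qθ τ θ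
        + F.coefQθ τ θ * pX F.Qθ τ θ := by
  have h1 := ((h.hasDerivAt_coefQτ τ θ).mul (F.sQτ.hasDerivAt_pT τ θ)).deriv
  have h2 := ((F.hasDerivAt_coefQθ_snd τ θ).mul (F.sQθ.hasDerivAt_pX τ θ)).deriv
  rw [← h1, ← h2]
  exact h.2.1 τ θ

variable (F)

theorem per_coefVθ (τ : ℝ) : Function.Periodic (F.coefVθ τ) 1 := fun θ => by
  simp only [coefVθ, F.periodic_ρ τ θ]
theorem per_coefQθ (τ : ℝ) : Function.Periodic (F.coefQθ τ) 1 := fun θ => by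
  simp only [coefQθ, F.periodic_ρ τ θ, F.periodic_V τ θ]

theorem hasDerivAt_Vθ_fst (τ θ : ℝ) :
    HasDerivAt (fun s => F.Vθ s θ) (pX F.Vτ τ θ) τ := by
  have := F.sVθ.hasDerivAt_pT τ θ
  rwa [show pT F.Vθ τ θ = pX F.Vτ τ θ from F.sV.pT_pX_comm τ θ] at this

theorem hasDerivAt_Qθ_fst (τ θ : ℝ) :
    HasDerivAt (fun s => F.Qθ s θ) (pX F.Qτ τ θ) τ := by
  have := F.sQθ.hasDerivAt_pT τ θ
  rwa [show pT F.Qθ τ θ = pX F.Qτ τ θ from F.sQ.pT_pX_comm τ θ] at this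

/-- The unnormalized energy `∫ e^ρ J`. -/
def K (τ : ℝ) : ℝ := ∫ θ in (0:ℝ)..1, F.kin τ θ
/-- The momentum `∫ e^ρ V_τ`. -/
def mom (τ : ℝ) : ℝ := ∫ θ in (0:ℝ)..1, exp (F.ρ τ θ) * F.Vτ τ θ
/-- The virial quantity `∫ e^ρ V_τ V`. -/
def vir (τ : ℝ) : ℝ := ∫ θ in (0:ℝ)..1, exp (F.ρ τ θ) * F.Vτ τ θ * F.V τ θ
/-- The `Q`-part of the conserved quantity `A`. -/
def rot (τ : ℝ) : ℝ := ∫ θ in (0:ℝ)..1, F.coefQτ τ θ * F.Qτ τ θ * F.Q τ θ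

theorem hasDerivAt_circleMean_V (τ : ℝ) :
    HasDerivAt (fun s => circleMean (F.V s)) (circleMean (F.Vτ τ)) τ :=
  F.sV.hasDerivAt_integral_pT τ

variable {F}

theorem IsEinsteinFlow.hasDerivAt_Pi (h : F.IsEinsteinFlow) (τ : ℝ) :
    HasDerivAt F.Pi (∫ θ in (0:ℝ)..1, exp (F.ρ τ θ) * exp (F.l τ θ)) τ := by
  refine F.sρ.exp.hasDerivAt_integral_of_balance' (φ := fun _ => 0) (φ' := fun _ => 0)
    (F.sρ.exp.mul F.sl.exp |>.continuous_right τ) (fun θ => hasDerivAt_const θ 0)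
    continuous_const (fun _ => rfl) fun θ => ?_
  simpa using (h.hasDerivAt_ρ τ θ).exp

theorem IsEinsteinFlow.hasDerivAt_Y (h : F.IsEinsteinFlow) (τ : ℝ) :
    HasDerivAt F.Y (exp (2*τ) * ∫ θ in (0:ℝ)..1, exp (F.l τ θ) * F.kin τ θ) τ := by
  have hs : SmoothField fun τ θ => exp (F.l τ θ + F.ρ τ θ + 2*τ) :=
    ((F.sl.add F.sρ).add ((SmoothField.const 2).mul SmoothField.time)).exp
  rw [← intervalIntegral.integral_const_mul]
  refine hs.hasDerivAt_integral_of_balance' (φ := fun _ => 0) (φ' := fun _ => 0)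
    ((F.sl.exp.mul F.s_kin |>.continuous_right τ).const_mul _) (fun θ => hasDerivAt_const θ 0)
    continuous_const (fun _ => rfl) fun θ => ?_
  have := (((h.hasDerivAt_l τ θ).add (h.hasDerivAt_ρ τ θ)).add
    ((hasDerivAt_id τ).const_mul 2)).exp
  refine this.congr_deriv ?_
  rw [← kin_eq]
  simp only [Pi.add_apply, id, exp_add]
  ring

theorem IsEinsteinFlow.hasDerivAt_K (h : F.IsEinsteinFlow) (τ : ℝ) :
    HasDerivAt F.K (∫ θ in (0:ℝ)..1,
      (-(exp (F.l τ θ) * F.kin τ θ) + (F.T₂ τ θ + F.T₃ τ θ))) τ := by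
  refine F.s_kin.hasDerivAt_integral_of_balance'
    (φ := fun x => F.coefVθ τ x * F.Vθ τ x * F.Vτ τ x + F.coefQθ τ x * F.Qθ τ x * F.Qτ τ x)
    (((F.sl.exp.mul F.s_kin).neg.add (F.s_T₂.add F.s_T₃)).continuous_right τ)
    (fun θ => (((F.hasDerivAt_coefVθ_snd τ θ).mul (F.sVθ.hasDerivAt_pX τ θ)).mul
      (F.sVτ.hasDerivAt_pX τ θ)).add (((F.hasDerivAt_coefQθ_snd τ θ).mul
      (F.sQθ.hasDerivAt_pX τ θ)).mul (F.sQτ.hasDerivAt_pX τ θ)))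
    ?_ ?_ fun θ => ?_
  · have := (((((F.s_coefVθ.mul F.sρ.pX.neg).mul F.sVθ).add (F.s_coefVθ.mul F.sVθ.pX)).mul
      F.sVτ).add ((F.s_coefVθ.mul F.sVθ).mul F.sVτ.pX)).add
      (((((F.s_coefQθ.mul (F.sρ.pX.neg.add (F.sVθ.const_mul 2))).mul F.sQθ).add
      (F.s_coefQθ.mul F.sQθ.pX)).mul F.sQτ).add ((F.s_coefQθ.mul F.sQθ).mul F.sQτ.pX))
    exact this.continuous_right τ
  · intro θ
    simp only [F.per_coefVθ τ θ, F.per_Vθ τ θ, F.per_Vτ τ θ, F.per_coefQθ τ θ, F.per_Qθ τ θ,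
      F.per_Qτ τ θ]
  · have d1 := (h.hasDerivAt_ρ τ θ).exp.mul ((F.sVτ.hasDerivAt_pT τ θ).pow 2)
    have d2 := (h.hasDerivAt_coefVθ τ θ).mul ((F.hasDerivAt_Vθ_fst τ θ).pow 2)
    have d3 := (h.hasDerivAt_coefQτ τ θ).mul ((F.sQτ.hasDerivAt_pT τ θ).pow 2)
    have d4 := (h.hasDerivAt_coefQθ τ θ).mul ((F.hasDerivAt_Qθ_fst τ θ).pow 2)
    refine ((((d1.add d2).add d3).add d4).const_mul (1/2)).congr_deriv ?_
    have eV := h.wave_V τ θ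
    have eQ := h.wave_Q τ θ
    simp only [kin, T₁, T₂, T₃, T₄, Pi.mul_apply, Pi.pow_apply] at eV eQ ⊢
    linear_combination F.Vτ τ θ * eV + F.Qτ τ θ * eQ

theorem IsEinsteinFlow.hasDerivAt_mom (h : F.IsEinsteinFlow) (τ : ℝ) :
    HasDerivAt F.mom (∫ θ in (0:ℝ)..1, (F.T₃ τ θ - F.T₄ τ θ)) τ := by
  refine (F.sρ.exp.mul F.sVτ).hasDerivAt_integral_of_balance'
    (φ := fun x => F.coefVθ τ x * F.Vθ τ x)
    ((F.s_T₃.sub F.s_T₄).continuous_right τ)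
    (fun θ => (F.hasDerivAt_coefVθ_snd τ θ).mul (F.sVθ.hasDerivAt_pX τ θ)) ?_ ?_ fun θ => ?_
  · exact (((F.s_coefVθ.mul F.sρ.pX.neg).mul F.sVθ).add
      (F.s_coefVθ.mul F.sVθ.pX)).continuous_right τ
  · intro θ
    simp only [F.per_coefVθ τ θ, F.per_Vθ τ θ]
  · refine ((h.hasDerivAt_ρ τ θ).exp.mul (F.sVτ.hasDerivAt_pT τ θ)).congr_deriv ?_
    linear_combination h.wave_V τ θ

theorem IsEinsteinFlow.hasDerivAt_vir (h : F.IsEinsteinFlow) (τ : ℝ) :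
    HasDerivAt F.vir (∫ θ in (0:ℝ)..1,
      (F.V τ θ * (F.T₃ τ θ - F.T₄ τ θ) + (F.T₁ τ θ - F.T₂ τ θ))) τ := by
  refine ((F.sρ.exp.mul F.sVτ).mul F.sV).hasDerivAt_integral_of_balance'
    (φ := fun x => F.coefVθ τ x * F.Vθ τ x * F.V τ x)
    (((F.sV.mul (F.s_T₃.sub F.s_T₄)).add (F.s_T₁.sub F.s_T₂)).continuous_right τ)
    (fun θ => ((F.hasDerivAt_coefVθ_snd τ θ).mul (F.sVθ.hasDerivAt_pX τ θ)).mul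
      (F.sV.hasDerivAt_pX τ θ)) ?_ ?_ fun θ => ?_
  · exact (((((F.s_coefVθ.mul F.sρ.pX.neg).mul F.sVθ).add
      (F.s_coefVθ.mul F.sVθ.pX)).mul F.sV).add
      ((F.s_coefVθ.mul F.sVθ).mul F.sV.pX)).continuous_right τ
  · intro θ
    simp only [F.per_coefVθ τ θ, F.per_Vθ τ θ, F.periodic_V τ θ]
  · refine (((h.hasDerivAt_ρ τ θ).exp.mul (F.sVτ.hasDerivAt_pT τ θ)).mul
      (F.sV.hasDerivAt_pT τ θ)).congr_deriv ?_
    have e1 : pT F.V τ θ = F.Vτ τ θ := rfl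
    have e2 : pX F.V τ θ = F.Vθ τ θ := rfl
    have eV := h.wave_V τ θ
    simp only [e1, e2, T₁, T₂, Pi.mul_apply]
    linear_combination F.V τ θ * eV

theorem IsEinsteinFlow.hasDerivAt_rot (h : F.IsEinsteinFlow) (τ : ℝ) :
    HasDerivAt F.rot (∫ θ in (0:ℝ)..1, (F.T₃ τ θ - F.T₄ τ θ)) τ := by
  refine ((F.s_coefQτ.mul F.sQτ).mul F.sQ).hasDerivAt_integral_of_balance'
    (φ := fun x => F.coefQθ τ x * F.Qθ τ x * F.Q τ x)
    ((F.s_T₃.sub F.s_T₄).continuous_right τ)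
    (fun θ => ((F.hasDerivAt_coefQθ_snd τ θ).mul (F.sQθ.hasDerivAt_pX τ θ)).mul
      (F.sQ.hasDerivAt_pX τ θ)) ?_ ?_ fun θ => ?_
  · exact (((((F.s_coefQθ.mul (F.sρ.pX.neg.add (F.sVθ.const_mul 2))).mul F.sQθ).add
      (F.s_coefQθ.mul F.sQθ.pX)).mul F.sQ).add
      ((F.s_coefQθ.mul F.sQθ).mul F.sQ.pX)).continuous_right τ
  · intro θ
    simp only [F.per_coefQθ τ θ, F.per_Qθ τ θ, F.periodic_Q τ θ]
  · refine (((h.hasDerivAt_coefQτ τ θ).mul (F.sQτ.hasDerivAt_pT τ θ)).mul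
      (F.sQ.hasDerivAt_pT τ θ)).congr_deriv ?_
    have e1 : pT F.Q τ θ = F.Qτ τ θ := rfl
    have e2 : pX F.Q τ θ = F.Qθ τ θ := rfl
    have eQ := h.wave_Q τ θ
    simp only [e1, e2, T₃, T₄, Pi.mul_apply]
    linear_combination F.Q τ θ * eQ

variable (F)

theorem A_eq (τ : ℝ) : F.A τ = F.mom τ - F.rot τ := by
  rw [mom, rot, ← integral_sub ((F.sρ.exp.mul F.sVτ).intervalIntegrable τ 0 1)
    (((F.s_coefQτ.mul F.sQτ).mul F.sQ).intervalIntegrable τ 0 1)]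
  refine integral_congr fun θ _ => ?_
  simp only [coefQτ, exp_add]
  ring

variable {F}

theorem IsEinsteinFlow.A_const (h : F.IsEinsteinFlow) (τ s : ℝ) : F.A τ = F.A s := by
  have h1 : ∀ τ, HasDerivAt F.A 0 τ := fun τ => by
    have e : F.A = fun τ => F.mom τ - F.rot τ := funext F.A_eq
    rw [e]
    exact ((h.hasDerivAt_mom τ).sub (h.hasDerivAt_rot τ)).congr_deriv (sub_self _)
  exact is_const_of_deriv_eq_zero (fun τ => (h1 τ).differentiableAt) (fun τ => (h1 τ).deriv) τ s

end T2Flow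

theorem abs_integral_le_of_abs_le {f g : ℝ → ℝ} (hg : Continuous g) (h : ∀ θ, |f θ| ≤ g θ) :
    |∫ θ in (0:ℝ)..1, f θ| ≤ ∫ θ in (0:ℝ)..1, g θ :=
  norm_integral_le_of_norm_le (f := f) (g := g) zero_le_one
    (Filter.Eventually.of_forall fun θ _ => h θ) (hg.intervalIntegrable 0 1)

namespace T2Flow

variable (F : T2Flow)

theorem Pi_pos (τ : ℝ) : 0 < F.Pi τ :=
  intervalIntegral_pos_of_pos (F.sρ.exp.intervalIntegrable τ 0 1) (fun _ => exp_pos _) zero_lt_one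

theorem K_nonneg (τ : ℝ) : 0 ≤ F.K τ :=
  integral_nonneg zero_le_one fun _ _ => F.kin_nonneg _ _

theorem E_eq (τ : ℝ) : F.E τ = exp (-2*τ) * F.K τ := by
  rw [E, K, ← intervalIntegral.integral_const_mul]
  refine integral_congr fun θ _ => ?_
  simp only [← F.kin_eq, ← mul_assoc, ← exp_add]
  ring_nf

theorem E_nonneg (τ : ℝ) : 0 ≤ F.E τ := by
  rw [E_eq]; exact mul_nonneg (exp_pos _).le (F.K_nonneg τ)

theorem Λ_eq (τ : ℝ) : F.Λ τ
    = 1/2 * exp (-2*τ) * (F.vir τ - circleMean (F.V τ) * F.mom τ - F.mom τ) := by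
  have i1 := ((F.sρ.exp.mul F.sVτ).mul F.sV).intervalIntegrable τ 0 1
  have i2 := ((F.sρ.exp.mul F.sVτ).const_mul (circleMean (F.V τ))).intervalIntegrable τ 0 1
  have i3 := (F.sρ.exp.mul F.sVτ).intervalIntegrable τ 0 1
  rw [Λ, vir, mom]
  congr 1
  rw [← intervalIntegral.integral_const_mul, ← intervalIntegral.integral_sub i1 i2,
    ← intervalIntegral.integral_sub (i1.sub i2) i3]
  exact integral_congr fun θ _ => by ring

/-- The logarithmic derivative of the volume. -/
def rate (τ : ℝ) : ℝ := (∫ θ in (0:ℝ)..1, exp (F.ρ τ θ) * exp (F.l τ θ)) / F.Pi τ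

theorem rate_pos (τ : ℝ) : 0 < F.rate τ :=
  div_pos (intervalIntegral_pos_of_pos ((F.sρ.exp.mul F.sl.exp).intervalIntegrable τ 0 1)
    (fun _ => mul_pos (exp_pos _) (exp_pos _)) zero_lt_one) (F.Pi_pos τ)

theorem integral_eq_rate_mul (τ : ℝ) :
    ∫ θ in (0:ℝ)..1, exp (F.ρ τ θ) * exp (F.l τ θ) = F.rate τ * F.Pi τ := by
  rw [rate, div_mul_cancel₀ _ (F.Pi_pos τ).ne']

theorem Y_eq (τ : ℝ) : F.Y τ = exp (2*τ) * (F.rate τ * F.Pi τ) := by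
  rw [Y, ← integral_eq_rate_mul, ← intervalIntegral.integral_const_mul]
  refine integral_congr fun θ _ => ?_
  simp only [exp_add]
  ring

/-- The covariance of `e^l` with the energy density. -/
def gap (τ : ℝ) : ℝ :=
  exp (-2*τ) * ((∫ θ in (0:ℝ)..1, exp (F.l τ θ) * F.kin τ θ) - F.rate τ * F.K τ)

/-- The error produced by the correction `Λ`. -/
def errV (τ : ℝ) : ℝ :=
  (∫ θ in (0:ℝ)..1, (F.V τ θ - circleMean (F.V τ)) * (F.T₃ τ θ - F.T₄ τ θ))
    - circleMean (F.Vτ τ) * F.mom τ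

/-- Normalized volume. -/
def nPi (τ : ℝ) : ℝ := F.Pi τ * exp (-τ/2)
/-- Normalized twist potential. -/
def nY (τ : ℝ) : ℝ := F.Y τ * exp (-5*τ/2)
/-- Normalized corrected energy. -/
def nH (τ : ℝ) : ℝ := exp τ * F.H τ
/-- Normalized uncorrected energy. -/
def nE (τ : ℝ) : ℝ := exp τ * (F.Pi τ * F.E τ)
/-- Normalized covariance. -/
def nGap (τ : ℝ) : ℝ := exp τ * (F.Pi τ * F.gap τ)
/-- The derivative of the normalized corrected energy. -/
def nH' (τ : ℝ) : ℝ :=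
  exp τ * F.Pi τ * (-(1 - F.rate τ) * F.Λ τ - F.gap τ + 1/2 * exp (-2*τ) * F.errV τ)

theorem exp_powers (τ : ℝ) : exp τ = exp (τ/2) ^ 2 ∧ exp (2*τ) = exp (τ/2) ^ 4 ∧
    exp (-2*τ) = (exp (τ/2) ^ 4)⁻¹ ∧ exp (-τ/2) = (exp (τ/2))⁻¹ ∧
    exp (-5*τ/2) = (exp (τ/2) ^ 5)⁻¹ ∧ exp (-τ) = (exp (τ/2) ^ 2)⁻¹ := by
  simp only [← exp_nat_mul, ← exp_neg]
  refine ⟨?_, ?_, ?_, ?_, ?_, ?_⟩ <;> congr 1 <;> push_cast <;> ring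

theorem nPi_pos (τ : ℝ) : 0 < F.nPi τ := mul_pos (F.Pi_pos τ) (exp_pos _)

theorem nY_eq (τ : ℝ) : F.nY τ = F.rate τ * F.nPi τ := by
  obtain ⟨-, e2, -, e4, e5, -⟩ := exp_powers τ
  have := exp_pos (τ/2)
  rw [nY, nPi, Y_eq, e2, e4, e5]
  field_simp

theorem nE_nonneg (τ : ℝ) : 0 ≤ F.nE τ :=
  mul_nonneg (exp_pos _).le (mul_nonneg (F.Pi_pos τ).le (F.E_nonneg τ))

variable {F}

theorem IsEinsteinFlow.hasDerivAt_nPi (h : F.IsEinsteinFlow) (τ : ℝ) :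
    HasDerivAt F.nPi (F.nY τ - F.nPi τ / 2) τ := by
  have h1 : HasDerivAt (fun s : ℝ => exp (-s/2)) (exp (-τ/2) * (-1/2)) τ :=
    (((hasDerivAt_id τ).neg).div_const 2).exp
  refine ((h.hasDerivAt_Pi τ).mul h1).congr_deriv ?_
  rw [integral_eq_rate_mul, nY_eq, nPi]
  ring

theorem IsEinsteinFlow.hasDerivAt_nY (h : F.IsEinsteinFlow) (τ : ℝ) :
    HasDerivAt F.nY (F.nY τ * F.nE τ / F.nPi τ ^ 2 + F.nGap τ / F.nPi τ - 5/2 * F.nY τ) τ := by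
  have h1 : HasDerivAt (fun s : ℝ => exp (-5*s/2)) (exp (-5*τ/2) * (-5/2)) τ := by
    have := (((hasDerivAt_id τ).const_mul (-5:ℝ)).div_const 2).exp
    simpa using this
  refine ((h.hasDerivAt_Y τ).mul h1).congr_deriv ?_
  obtain ⟨e1, e2, e3, e4, e5, -⟩ := exp_powers τ
  have hb := exp_pos (τ/2)
  have hP := F.Pi_pos τ
  have hG : (∫ θ in (0:ℝ)..1, exp (F.l τ θ) * F.kin τ θ)
      = exp (2*τ) * F.gap τ + F.rate τ * F.K τ := by
    rw [gap, e2, e3]; field_simp; ring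
  rw [hG, nE, nGap, nY_eq, nPi, E_eq, Y_eq, e1, e2, e3, e4, e5]
  field_simp
  ring

theorem IsEinsteinFlow.hasDerivAt_nH (h : F.IsEinsteinFlow) (τ : ℝ) :
    HasDerivAt F.nH (F.nH' τ) τ := by
  have hE : F.nH = fun τ => exp τ * (F.Pi τ * (exp (-2*τ) *
      (F.K τ + 1/2 * (F.vir τ - circleMean (F.V τ) * F.mom τ - F.mom τ)))) := by
    funext s; rw [nH, H, E_eq, Λ_eq]; ring
  have h1 : HasDerivAt (fun s : ℝ => exp (-2*s)) (exp (-2*τ) * (-2)) τ := by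
    have := ((hasDerivAt_id τ).const_mul (-2:ℝ)).exp
    simpa using this
  rw [hE]
  refine ((Real.hasDerivAt_exp τ).mul ((h.hasDerivAt_Pi τ).mul (h1.mul ((h.hasDerivAt_K τ).add
    ((((h.hasDerivAt_vir τ).sub ((F.hasDerivAt_circleMean_V τ).mul (h.hasDerivAt_mom τ))).sub
      (h.hasDerivAt_mom τ)).const_mul (1/2)))))).congr_deriv ?_
  have i1 := F.s_T₁.intervalIntegrable τ 0 1
  have i2 := F.s_T₂.intervalIntegrable τ 0 1
  have i3 := F.s_T₃.intervalIntegrable τ 0 1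
  have i4 := F.s_T₄.intervalIntegrable τ 0 1
  have ik := (F.sl.exp.mul F.s_kin).intervalIntegrable τ 0 1
  have iV := (F.sV.mul (F.s_T₃.sub F.s_T₄)).intervalIntegrable τ 0 1
  have hK : F.K τ = 1/2 * ((∫ θ in (0:ℝ)..1, F.T₁ τ θ) + (∫ θ in (0:ℝ)..1, F.T₂ τ θ)
      + (∫ θ in (0:ℝ)..1, F.T₃ τ θ) + ∫ θ in (0:ℝ)..1, F.T₄ τ θ) := by
    simp only [K, kin]
    rw [intervalIntegral.integral_const_mul, integral_add ((i1.add i2).add i3) i4,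
      integral_add (i1.add i2) i3, integral_add i1 i2]
  have a1 : ∫ θ in (0:ℝ)..1, (-(exp (F.l τ θ) * F.kin τ θ) + (F.T₂ τ θ + F.T₃ τ θ))
      = -(∫ θ in (0:ℝ)..1, exp (F.l τ θ) * F.kin τ θ)
        + ((∫ θ in (0:ℝ)..1, F.T₂ τ θ) + ∫ θ in (0:ℝ)..1, F.T₃ τ θ) := by
    have ikn : IntervalIntegrable (fun θ => -(exp (F.l τ θ) * F.kin τ θ)) volume 0 1 := ik.neg
    rw [integral_add ikn (i2.add i3), integral_add i2 i3, intervalIntegral.integral_neg]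
  have a2 : ∫ θ in (0:ℝ)..1, (F.T₃ τ θ - F.T₄ τ θ)
      = (∫ θ in (0:ℝ)..1, F.T₃ τ θ) - ∫ θ in (0:ℝ)..1, F.T₄ τ θ := intervalIntegral.integral_sub i3 i4
  have a3 : ∫ θ in (0:ℝ)..1, (F.V τ θ * (F.T₃ τ θ - F.T₄ τ θ) + (F.T₁ τ θ - F.T₂ τ θ))
      = (∫ θ in (0:ℝ)..1, F.V τ θ * (F.T₃ τ θ - F.T₄ τ θ))
        + ((∫ θ in (0:ℝ)..1, F.T₁ τ θ) - ∫ θ in (0:ℝ)..1, F.T₂ τ θ) := by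
    rw [integral_add iV (i1.sub i2), intervalIntegral.integral_sub i1 i2]
  have a4 : ∫ θ in (0:ℝ)..1, (F.V τ θ - circleMean (F.V τ)) * (F.T₃ τ θ - F.T₄ τ θ)
      = (∫ θ in (0:ℝ)..1, F.V τ θ * (F.T₃ τ θ - F.T₄ τ θ))
        - circleMean (F.V τ) * ((∫ θ in (0:ℝ)..1, F.T₃ τ θ) - ∫ θ in (0:ℝ)..1, F.T₄ τ θ) := by
    simp only [sub_mul (F.V τ _)]
    rw [intervalIntegral.integral_sub iV ((i3.sub i4).const_mul _), intervalIntegral.integral_const_mul, a2]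
  rw [nH', errV, gap, a1, a2, a3, a4, integral_eq_rate_mul, Λ_eq]
  simp only [Pi.mul_apply, Pi.add_apply, Pi.sub_apply]
  rw [hK]
  ring

variable (F)

/-- The basic small quantity controlling oscillations. -/
def osc (τ : ℝ) : ℝ := √(2 * F.E τ * F.Pi τ)

theorem osc_nonneg (τ : ℝ) : 0 ≤ F.osc τ := sqrt_nonneg _

theorem sq_osc (τ : ℝ) : F.osc τ ^ 2 = 2 * F.E τ * F.Pi τ :=
  sq_sqrt (mul_nonneg (mul_nonneg zero_le_two (F.E_nonneg τ)) (F.Pi_pos τ).le)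

theorem integral_T_le (τ : ℝ) {f : ℝ → ℝ} (hf : Continuous f)
    (h : ∀ θ, f θ ≤ F.T₁ τ θ + F.T₂ τ θ + F.T₃ τ θ + F.T₄ τ θ) :
    ∫ θ in (0:ℝ)..1, f θ ≤ 2 * (exp (2*τ) * F.E τ) := by
  have : exp (2*τ) * F.E τ = F.K τ := by
    rw [E_eq, ← mul_assoc, ← exp_add]; simp
  rw [this, K, ← intervalIntegral.integral_const_mul]
  refine integral_mono zero_le_one (hf.intervalIntegrable 0 1)
    ((F.s_kin.const_mul 2).intervalIntegrable τ 0 1) fun θ => ?_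
  have := h θ
  simp only [kin]; linarith

/-- Cauchy–Schwarz against the volume density. -/
theorem integral_le_osc (τ : ℝ) {h b : ℝ → ℝ} (hh : Continuous h) (hb : Continuous b)
    (hb0 : ∀ θ, 0 ≤ b θ) (hbT : ∀ θ, b θ ≤ F.T₁ τ θ + F.T₂ τ θ + F.T₃ τ θ + F.T₄ τ θ)
    (hab : ∀ θ, h θ ^ 2 ≤ exp (F.ρ τ θ) * b θ) :
    ∫ θ in (0:ℝ)..1, h θ ≤ exp τ * F.osc τ := by
  have h1 := sq_integral_le_mul (F.sρ.exp.continuous_right τ) hb hh (fun θ => (exp_pos _).le)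
    hb0 hab
  have h2 := F.integral_T_le τ hb hbT
  have h3 : (∫ θ in (0:ℝ)..1, h θ) ^ 2 ≤ (exp τ * F.osc τ) ^ 2 := by
    refine h1.trans ((mul_le_mul_of_nonneg_left h2 (F.Pi_pos τ).le).trans_eq ?_)
    rw [mul_pow, sq_osc, ← exp_nat_mul]
    push_cast; ring
  exact (le_abs_self _).trans
    (abs_le_of_sq_le_sq h3 (mul_nonneg (exp_pos _).le (F.osc_nonneg τ)))

theorem integral_abs_Vθ_le (τ : ℝ) : ∫ θ in (0:ℝ)..1, |F.Vθ τ θ| ≤ F.osc τ := by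
  have h1 := F.integral_le_osc τ (h := fun θ => exp τ * |F.Vθ τ θ|) (b := F.T₂ τ)
    ((F.sVθ.continuous_right τ).abs.const_mul _) (F.s_T₂.continuous_right τ) (F.T₂_nonneg τ)
    (fun θ => by linarith [F.T₁_nonneg τ θ, F.T₃_nonneg τ θ, F.T₄_nonneg τ θ])
    (fun θ => by
      rw [mul_pow, sq_abs, T₂, coefVθ, ← mul_assoc, ← exp_add, ← exp_nat_mul]
      refine le_of_eq ?_
      congr 2; push_cast; ring)
  rw [intervalIntegral.integral_const_mul] at h1
  exact le_of_mul_le_mul_left h1 (exp_pos _)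

theorem integral_abs_Qθ_le (τ : ℝ) :
    ∫ θ in (0:ℝ)..1, exp (F.V τ θ - τ) * |F.Qθ τ θ| ≤ F.osc τ := by
  have h1 := F.integral_le_osc τ (h := fun θ => exp τ * (exp (F.V τ θ - τ) * |F.Qθ τ θ|))
    (b := F.T₄ τ)
    (((F.sV.sub SmoothField.time).exp.continuous_right τ).mul
      (F.sQθ.continuous_right τ).abs |>.const_mul _)
    (F.s_T₄.continuous_right τ) (F.T₄_nonneg τ)
    (fun θ => by linarith [F.T₁_nonneg τ θ, F.T₃_nonneg τ θ, F.T₂_nonneg τ θ])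
    (fun θ => by
      rw [← mul_assoc, mul_pow, sq_abs, T₄, coefQθ, ← mul_assoc, ← exp_add, ← exp_add,
        ← exp_nat_mul]
      refine le_of_eq ?_
      congr 2; push_cast; ring)
  rw [intervalIntegral.integral_const_mul] at h1
  exact le_of_mul_le_mul_left h1 (exp_pos _)

theorem integral_abs_Vτ_le (τ : ℝ) :
    ∫ θ in (0:ℝ)..1, exp (F.ρ τ θ) * |F.Vτ τ θ| ≤ exp τ * F.osc τ :=
  F.integral_le_osc τ (h := fun θ => exp (F.ρ τ θ) * |F.Vτ τ θ|) (b := F.T₁ τ)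
    ((F.sρ.exp.continuous_right τ).mul (F.sVτ.continuous_right τ).abs)
    (F.s_T₁.continuous_right τ) (F.T₁_nonneg τ)
    (fun θ => by linarith [F.T₂_nonneg τ θ, F.T₃_nonneg τ θ, F.T₄_nonneg τ θ])
    (fun θ => by
      rw [mul_pow, sq_abs, T₁, ← mul_assoc, sq])

theorem integral_abs_Qτ_le (τ : ℝ) :
    ∫ θ in (0:ℝ)..1, exp (F.ρ τ θ + (F.V τ θ - τ)) * |F.Qτ τ θ| ≤ exp τ * F.osc τ :=
  F.integral_le_osc τ (h := fun θ => exp (F.ρ τ θ + (F.V τ θ - τ)) * |F.Qτ τ θ|) (b := F.T₃ τ)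
    (((F.sρ.add (F.sV.sub SmoothField.time)).exp.continuous_right τ).mul
      (F.sQτ.continuous_right τ).abs)
    (F.s_T₃.continuous_right τ) (F.T₃_nonneg τ)
    (fun θ => by linarith [F.T₂_nonneg τ θ, F.T₁_nonneg τ θ, F.T₄_nonneg τ θ])
    (fun θ => by
      rw [mul_pow, sq_abs, T₃, coefQτ, ← mul_assoc, ← exp_add, ← exp_nat_mul]
      refine le_of_eq ?_
      congr 2; push_cast; ring)

theorem abs_V_sub_le (τ x y : ℝ) : |F.V τ x - F.V τ y| ≤ F.osc τ :=
  (abs_sub_le_integral_abs (F.sV.hasDerivAt_pX τ) (F.sVθ.continuous_right τ)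
    (F.periodic_V τ) x y).trans (F.integral_abs_Vθ_le τ)

theorem abs_V_sub_mean_le (τ x : ℝ) : |F.V τ x - circleMean (F.V τ)| ≤ F.osc τ :=
  abs_sub_circleMean_le (F.sV.continuous_right τ) (F.abs_V_sub_le τ x)

theorem Q_sub_mean_le (τ x : ℝ) :
    exp (F.V τ x - τ) * |F.Q τ x - circleMean (F.Q τ)| ≤ exp (F.osc τ) * F.osc τ := by
  have h1 : |F.Q τ x - circleMean (F.Q τ)| ≤ ∫ θ in (0:ℝ)..1, |F.Qθ τ θ| :=
    abs_sub_circleMean_le (F.sQ.continuous_right τ)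
      (abs_sub_le_integral_abs (F.sQ.hasDerivAt_pX τ) (F.sQθ.continuous_right τ)
        (F.periodic_Q τ) x)
  refine (mul_le_mul_of_nonneg_left h1 (exp_pos _).le).trans ?_
  refine le_trans ?_ (mul_le_mul_of_nonneg_left (F.integral_abs_Qθ_le τ) (exp_pos _).le)
  rw [← intervalIntegral.integral_const_mul, ← intervalIntegral.integral_const_mul]
  refine integral_mono zero_le_one
    ((F.sQθ.continuous_right τ).abs.const_mul _ |>.intervalIntegrable 0 1)
    (((((F.sV.sub SmoothField.time).exp.continuous_right τ).mul
      (F.sQθ.continuous_right τ).abs).const_mul _).intervalIntegrable 0 1) fun θ => ?_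
  simp only [← mul_assoc, ← exp_add]
  refine mul_le_mul_of_nonneg_right (exp_le_exp.2 ?_) (abs_nonneg _)
  have := (abs_le.1 (F.abs_V_sub_le τ x θ)).2
  linarith

theorem abs_vir_sub_le (τ : ℝ) :
    |F.vir τ - circleMean (F.V τ) * F.mom τ| ≤ exp τ * F.osc τ ^ 2 := by
  have e : F.vir τ - circleMean (F.V τ) * F.mom τ
      = ∫ θ in (0:ℝ)..1, exp (F.ρ τ θ) * F.Vτ τ θ * (F.V τ θ - circleMean (F.V τ)) := by
    rw [vir, mom, ← intervalIntegral.integral_const_mul, ← intervalIntegral.integral_sub]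
    · exact integral_congr fun θ _ => by ring
    · exact ((F.sρ.exp.mul F.sVτ).mul F.sV).intervalIntegrable τ 0 1
    · exact ((F.sρ.exp.mul F.sVτ).const_mul _).intervalIntegrable τ 0 1
  have h2 := mul_le_mul_of_nonneg_left (F.integral_abs_Vτ_le τ) (F.osc_nonneg τ)
  rw [← intervalIntegral.integral_const_mul] at h2
  have h3 : F.osc τ * (exp τ * F.osc τ) = exp τ * F.osc τ ^ 2 := by ring
  rw [e, ← h3]
  refine (abs_integral_le_of_abs_le
    (((F.sρ.exp.continuous_right τ).mul (F.sVτ.continuous_right τ).abs).const_mul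
      (F.osc τ)) fun θ => ?_).trans h2
  rw [abs_mul, abs_mul, abs_of_pos (exp_pos _), mul_comm (F.osc τ)]
  exact mul_le_mul_of_nonneg_left (F.abs_V_sub_mean_le τ θ) (by positivity)

theorem abs_rot_le (hB : F.B τ = 0) : |F.rot τ| ≤ exp τ * F.osc τ ^ 2 * exp (F.osc τ) := by
  have e : F.rot τ = ∫ θ in (0:ℝ)..1,
      F.coefQτ τ θ * F.Qτ τ θ * (F.Q τ θ - circleMean (F.Q τ)) := by
    have : F.rot τ = F.rot τ - circleMean (F.Q τ) * F.B τ := by rw [hB]; ring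
    rw [this, rot, B, ← intervalIntegral.integral_const_mul, ← intervalIntegral.integral_sub]
    · exact integral_congr fun θ _ => by simp only [coefQτ]; ring
    · exact ((F.s_coefQτ.mul F.sQτ).mul F.sQ).intervalIntegrable τ 0 1
    · exact ((F.s_coefQτ.mul F.sQτ).const_mul _).intervalIntegrable τ 0 1
  have h2 := mul_le_mul_of_nonneg_left (F.integral_abs_Qτ_le τ)
    (mul_nonneg (exp_pos (F.osc τ)).le (F.osc_nonneg τ))
  rw [← intervalIntegral.integral_const_mul] at h2
  have h3 : exp (F.osc τ) * F.osc τ * (exp τ * F.osc τ) = exp τ * F.osc τ ^ 2 * exp (F.osc τ) := by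
    ring
  rw [e, ← h3]
  refine (abs_integral_le_of_abs_le
    ((((F.sρ.add (F.sV.sub SmoothField.time)).exp.continuous_right τ).mul
      (F.sQτ.continuous_right τ).abs).const_mul
      (exp (F.osc τ) * F.osc τ)) fun θ => ?_).trans h2
  have e3 : F.coefQτ τ θ = exp (F.ρ τ θ + (F.V τ θ - τ)) * exp (F.V τ θ - τ) := by
    rw [coefQτ, ← exp_add]; ring_nf
  rw [abs_mul, abs_mul, e3, abs_of_pos (by positivity)]
  have := mul_le_mul_of_nonneg_left (F.Q_sub_mean_le τ θ)
    (by positivity : 0 ≤ exp (F.ρ τ θ + (F.V τ θ - τ)) * |F.Qτ τ θ|)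
  simp only [Pi.mul_apply]
  linarith

theorem abs_mom_le (hB : F.B τ = 0) :
    |F.mom τ| ≤ |F.A τ| + exp τ * F.osc τ ^ 2 * exp (F.osc τ) := by
  have e : F.mom τ = F.A τ + F.rot τ := by rw [A_eq]; ring
  rw [e]
  exact (abs_add_le _ _).trans (add_le_add_right (F.abs_rot_le hB) _)

theorem abs_Λ_le (hB : F.B τ = 0) : |F.Λ τ| ≤ 1/2 * exp (-2*τ) *
    (exp τ * F.osc τ ^ 2 + (|F.A τ| + exp τ * F.osc τ ^ 2 * exp (F.osc τ))) := by
  rw [Λ_eq, abs_mul, abs_of_pos (by positivity)]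
  exact mul_le_mul_of_nonneg_left
    ((abs_sub _ _).trans (add_le_add (F.abs_vir_sub_le τ) (F.abs_mom_le hB))) (by positivity)

theorem abs_integral_V_le (τ : ℝ) :
    |∫ θ in (0:ℝ)..1, (F.V τ θ - circleMean (F.V τ)) * (F.T₃ τ θ - F.T₄ τ θ)|
      ≤ F.osc τ * (2 * (exp (2*τ) * F.E τ)) := by
  have h2 := mul_le_mul_of_nonneg_left (F.integral_T_le τ
    ((F.s_T₃.add F.s_T₄).continuous_right τ) (fun θ => by
      linarith [F.T₁_nonneg τ θ, F.T₂_nonneg τ θ])) (F.osc_nonneg τ)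
  rw [← intervalIntegral.integral_const_mul] at h2
  refine (abs_integral_le_of_abs_le
    (((F.s_T₃.add F.s_T₄).const_mul (F.osc τ)).continuous_right τ) fun θ => ?_).trans h2
  rw [abs_mul]
  refine mul_le_mul (F.abs_V_sub_mean_le τ θ) ?_ (abs_nonneg _) (F.osc_nonneg τ)
  rw [abs_le]
  constructor <;> linarith [F.T₃_nonneg τ θ, F.T₄_nonneg τ θ]

theorem sq_circleMean_Vτ_le (τ : ℝ) : circleMean (F.Vτ τ) ^ 2
    ≤ (∫ θ in (0:ℝ)..1, exp (-F.ρ τ θ)) * (2 * (exp (2*τ) * F.E τ)) := by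
  have hc : Continuous fun θ => exp (-F.ρ τ θ) := F.sρ.neg.exp.continuous_right τ
  refine (sq_integral_le_mul hc (F.s_T₁.continuous_right τ)
    (F.sVτ.continuous_right τ) (fun θ => (exp_pos _).le) (F.T₁_nonneg τ) fun θ => ?_).trans
    (mul_le_mul_of_nonneg_left (F.integral_T_le τ (F.s_T₁.continuous_right τ) fun θ => by
      linarith [F.T₂_nonneg τ θ, F.T₃_nonneg τ θ, F.T₄_nonneg τ θ])
      (integral_nonneg zero_le_one fun _ _ => (exp_pos _).le))
  rw [T₁, ← mul_assoc, ← exp_add]; simp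

variable {F}

theorem IsEinsteinFlow.abs_l_sub_le (h : F.IsEinsteinFlow) (τ x y : ℝ) :
    |F.l τ x - F.l τ y| ≤ exp τ * F.E τ := by
  refine (abs_sub_le_integral_abs (F.sl.hasDerivAt_pX τ) (F.sl.pX.continuous_right τ)
    (F.periodic_l τ) x y).trans ?_
  have e : exp τ * F.E τ = ∫ θ in (0:ℝ)..1, exp (-τ) * F.kin τ θ := by
    rw [intervalIntegral.integral_const_mul, E_eq, K, ← mul_assoc, ← exp_add]; ring_nf
  rw [e]
  refine integral_mono zero_le_one ((F.sl.pX.continuous_right τ).abs.intervalIntegrable 0 1)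
    ((F.s_kin.const_mul _).intervalIntegrable τ 0 1) fun θ => ?_
  have e1 : pX F.l τ θ = _ := h.2.2.2.2 τ θ
  have e2 : F.coefVθ τ θ = exp τ ^ 2 * (exp (F.ρ τ θ))⁻¹ := by
    rw [coefVθ, ← exp_nat_mul, ← exp_neg, ← exp_add]; push_cast; ring_nf
  have e3 : F.coefQτ τ θ = exp (F.ρ τ θ) * exp (2*(F.V τ θ - τ)) := by rw [coefQτ, exp_add]
  have e4 : F.coefQθ τ θ = exp τ ^ 2 * (exp (F.ρ τ θ))⁻¹ * exp (2*(F.V τ θ - τ)) := by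
    rw [coefQθ, ← exp_nat_mul, ← exp_neg, ← exp_add, ← exp_add]; push_cast; ring_nf
  simp only [e1, kin, T₁, T₂, T₃, T₄, e2, e3, e4, exp_neg]
  have key : ∀ a b u v : ℝ, 0 < a → 0 < b →
      |u * v| ≤ b⁻¹ * (1/2 * (a * v^2 + b^2 * a⁻¹ * u^2)) := by
    intro a b u v ha hb
    have : b⁻¹ * (1/2 * (a * v^2 + b^2 * a⁻¹ * u^2)) = (a^2*v^2 + b^2*u^2) / (2*a*b) := by
      field_simp
    rw [this, le_div_iff₀ (by positivity), abs_mul]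
    nlinarith [sq_nonneg (a * |v| - b * |u|), sq_abs u, sq_abs v]
  have k1 := key (exp (F.ρ τ θ)) (exp τ) (F.Vθ τ θ) (F.Vτ τ θ) (exp_pos _) (exp_pos _)
  have k2 := mul_le_mul_of_nonneg_left
    (key (exp (F.ρ τ θ)) (exp τ) (F.Qθ τ θ) (F.Qτ τ θ) (exp_pos _) (exp_pos _))
    (exp_pos (2*(F.V τ θ - τ))).le
  have k3 : |exp (2*(F.V τ θ - τ)) * F.Qθ τ θ * F.Qτ τ θ|
      = exp (2*(F.V τ θ - τ)) * |F.Qθ τ θ * F.Qτ τ θ| := by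
    rw [mul_assoc, abs_mul, abs_of_pos (exp_pos _)]
  refine (abs_add_le _ _).trans ?_
  rw [k3]
  refine (add_le_add k1 k2).trans_eq ?_
  ring

theorem IsEinsteinFlow.abs_l_sub_mean_le (h : F.IsEinsteinFlow) (τ x : ℝ) :
    |F.l τ x - circleMean (F.l τ)| ≤ exp τ * F.E τ :=
  abs_sub_circleMean_le (F.sl.continuous_right τ) (h.abs_l_sub_le τ x)

theorem IsEinsteinFlow.abs_exp_l_sub_rate_le (h : F.IsEinsteinFlow) (τ x : ℝ) :
    |exp (F.l τ x) - F.rate τ| ≤ F.rate τ * (exp (exp τ * F.E τ) - 1) := by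
  set w := exp τ * F.E τ with hw
  have hw0 : 0 ≤ w := mul_nonneg (exp_pos _).le (F.E_nonneg τ)
  have hP := F.Pi_pos τ
  have hi := (F.sρ.exp.mul F.sl.exp).intervalIntegrable τ 0 1
  have h1 : exp (F.l τ x - w) * F.Pi τ ≤ F.rate τ * F.Pi τ := by
    rw [← integral_eq_rate_mul, Pi, ← intervalIntegral.integral_const_mul]
    refine integral_mono zero_le_one ((F.sρ.exp.const_mul _).intervalIntegrable τ 0 1) hi
      fun θ => ?_
    simp only
    rw [mul_comm]
    refine mul_le_mul_of_nonneg_left (exp_le_exp.2 ?_) (exp_pos _).le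
    linarith [(abs_le.1 (h.abs_l_sub_le τ x θ)).2]
  have h2 : F.rate τ * F.Pi τ ≤ exp (F.l τ x + w) * F.Pi τ := by
    rw [← integral_eq_rate_mul, Pi, ← intervalIntegral.integral_const_mul]
    refine integral_mono zero_le_one hi ((F.sρ.exp.const_mul _).intervalIntegrable τ 0 1)
      fun θ => ?_
    simp only
    rw [mul_comm]
    refine mul_le_mul_of_nonneg_right (exp_le_exp.2 ?_) (exp_pos _).le
    linarith [(abs_le.1 (h.abs_l_sub_le τ x θ)).1]
  have h1' := le_of_mul_le_mul_right h1 hP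
  have h2' := le_of_mul_le_mul_right h2 hP
  rw [exp_sub, div_le_iff₀ (exp_pos _)] at h1'
  rw [exp_add] at h2'
  have hm := F.rate_pos τ
  have hW : 1 ≤ exp w := one_le_exp hw0
  rw [abs_le]
  constructor
  · have h3 : F.rate τ * (2 - exp w) * exp w ≤ exp (F.l τ x) * exp w := by
      nlinarith [mul_nonneg hm.le (sq_nonneg (exp w - 1))]
    have := le_of_mul_le_mul_right h3 (exp_pos _)
    linarith
  · linarith

theorem IsEinsteinFlow.abs_gap_le (h : F.IsEinsteinFlow) (τ : ℝ) :
    |F.gap τ| ≤ F.rate τ * (exp (exp τ * F.E τ) - 1) * F.E τ := by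
  have e : (∫ θ in (0:ℝ)..1, exp (F.l τ θ) * F.kin τ θ) - F.rate τ * F.K τ
      = ∫ θ in (0:ℝ)..1, (exp (F.l τ θ) - F.rate τ) * F.kin τ θ := by
    rw [K, ← intervalIntegral.integral_const_mul, ← intervalIntegral.integral_sub]
    · exact integral_congr fun θ _ => by ring
    · exact (F.sl.exp.mul F.s_kin).intervalIntegrable τ 0 1
    · exact (F.s_kin.const_mul _).intervalIntegrable τ 0 1
  have h1 : |∫ θ in (0:ℝ)..1, (exp (F.l τ θ) - F.rate τ) * F.kin τ θ|
      ≤ F.rate τ * (exp (exp τ * F.E τ) - 1) * F.K τ := by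
    rw [K, ← intervalIntegral.integral_const_mul]
    refine abs_integral_le_of_abs_le ((F.s_kin.const_mul _).continuous_right τ) fun θ => ?_
    rw [abs_mul, abs_of_nonneg (F.kin_nonneg τ θ)]
    exact mul_le_mul_of_nonneg_right (h.abs_exp_l_sub_rate_le τ θ) (F.kin_nonneg τ θ)
  rw [gap, e, abs_mul, abs_of_pos (exp_pos _)]
  refine (mul_le_mul_of_nonneg_left h1 (exp_pos _).le).trans_eq ?_
  have := F.E_eq τ
  generalize exp (exp τ * F.E τ) = R
  rw [this]; ring

end T2Flow

namespace T2Flow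

/-- A priori bounds on the normalized quantities at one time. -/
structure Regime (F : T2Flow) (τ : ℝ) : Prop where
  nE_le : F.nE τ ≤ 16
  le_nPi : 1/4 ≤ F.nPi τ
  nPi_le : F.nPi τ ≤ 3
  rate_le : F.rate τ ≤ 1
  abs_A_le : |F.A τ| ≤ 1
  B_eq : F.B τ = 0
  exp_le : exp (-τ/2) ≤ 1/100

namespace Regime

variable {F : T2Flow} {τ : ℝ}

theorem Pi_eq (F : T2Flow) (τ : ℝ) : F.Pi τ = F.nPi τ / exp (-τ/2) := by
  rw [nPi, mul_div_cancel_right₀ _ (exp_pos _).ne']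

theorem exp_eq (τ : ℝ) : exp τ = (exp (-τ/2) ^ 2)⁻¹ ∧ exp (2*τ) = (exp (-τ/2) ^ 4)⁻¹ ∧
    exp (-2*τ) = exp (-τ/2) ^ 4 := by
  simp only [← exp_nat_mul, ← exp_neg]
  refine ⟨?_, ?_, ?_⟩ <;> congr 1 <;> push_cast <;> ring

theorem E_eq (F : T2Flow) (τ : ℝ) : F.E τ = F.nE τ * exp (-τ/2) ^ 3 / F.nPi τ := by
  have h := F.Pi_pos τ
  have := exp_pos (-τ/2)
  rw [nE, nPi, (exp_eq τ).1]
  field_simp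

theorem sq_osc (F : T2Flow) (τ : ℝ) : F.osc τ ^ 2 = 2 * F.nE τ * exp (-τ/2) ^ 2 := by
  have := exp_pos (-τ/2)
  rw [T2Flow.sq_osc, nE, (exp_eq τ).1]
  field_simp

theorem osc_le (h : F.Regime τ) : F.osc τ ≤ 6 * exp (-τ/2) := by
  refine (abs_le_of_sq_le_sq' ?_ (by positivity)).2
  rw [sq_osc, mul_pow]
  nlinarith [h.nE_le, pow_pos (exp_pos (-τ/2)) 2]

theorem exp_osc_le (h : F.Regime τ) : exp (F.osc τ) ≤ 3 := by
  have : F.osc τ ≤ 1 := by linarith [h.osc_le, h.exp_le]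
  exact (exp_le_exp.2 this).trans (by linarith [exp_one_lt_d9])

theorem exp_mul_E_eq (F : T2Flow) (τ : ℝ) : exp τ * F.E τ = F.nE τ * exp (-τ/2) / F.nPi τ := by
  have := exp_pos (-τ/2)
  have := F.nPi_pos τ
  rw [E_eq, (exp_eq τ).1]
  field_simp

theorem nE_div_le (h : F.Regime τ) : F.nE τ / F.nPi τ ≤ 64 := by
  rw [div_le_iff₀ (F.nPi_pos τ)]
  linarith [h.nE_le, h.le_nPi]

theorem exp_mul_E_le (h : F.Regime τ) : exp τ * F.E τ ≤ 64 * exp (-τ/2) := by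
  rw [exp_mul_E_eq, mul_div_right_comm]
  exact mul_le_mul_of_nonneg_right h.nE_div_le (exp_pos _).le

theorem exp_sub_one_le (h : F.Regime τ) : exp (exp τ * F.E τ) - 1 ≤ 128 * exp (-τ/2) := by
  have h0 : 0 ≤ exp τ * F.E τ := mul_nonneg (exp_pos _).le (F.E_nonneg τ)
  have h1 := h.exp_mul_E_le
  have h2 : |exp τ * F.E τ| ≤ 1 := by rw [abs_of_nonneg h0]; linarith [h.exp_le]
  have := abs_exp_sub_one_le h2
  rw [abs_of_nonneg h0] at this
  linarith [le_abs_self (exp (exp τ * F.E τ) - 1)]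

theorem abs_exp_l_sub_rate_le (hF : F.IsEinsteinFlow) (h : F.Regime τ) (θ : ℝ) :
    |exp (F.l τ θ) - F.rate τ| ≤ 128 * exp (-τ/2) := by
  have h0 : 0 ≤ exp τ * F.E τ := mul_nonneg (exp_pos _).le (F.E_nonneg τ)
  refine (hF.abs_exp_l_sub_rate_le τ θ).trans ((mul_le_of_le_one_left ?_ h.rate_le).trans
    h.exp_sub_one_le)
  linarith [one_le_exp h0]

theorem abs_nGap_le (hF : F.IsEinsteinFlow) (h : F.Regime τ) :
    |F.nGap τ| ≤ 2048 * exp (-τ/2) := by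
  have h0 : 0 ≤ exp τ * F.E τ := mul_nonneg (exp_pos _).le (F.E_nonneg τ)
  have h1 : F.rate τ * (exp (exp τ * F.E τ) - 1) ≤ 128 * exp (-τ/2) :=
    (mul_le_of_le_one_left (by linarith [one_le_exp h0]) h.rate_le).trans h.exp_sub_one_le
  have h2 : 0 ≤ exp τ * F.Pi τ := mul_nonneg (exp_pos _).le (F.Pi_pos τ).le
  have h3 := mul_le_mul_of_nonneg_left (hF.abs_gap_le τ) h2
  have e : |F.nGap τ| = exp τ * F.Pi τ * |F.gap τ| := by
    rw [nGap, ← mul_assoc, abs_mul, abs_of_nonneg h2]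
  have h4 := mul_le_mul h1 h.nE_le (F.nE_nonneg τ) (by positivity)
  have e2 : exp τ * F.Pi τ * (F.rate τ * (exp (exp τ * F.E τ) - 1) * F.E τ)
      = F.rate τ * (exp (exp τ * F.E τ) - 1) * F.nE τ := by
    generalize exp (exp τ * F.E τ) = R
    rw [nE]; ring
  rw [e]; linarith

theorem abs_mom_le (h : F.Regime τ) : |F.mom τ| ≤ 97 := by
  have h1 := F.abs_mom_le h.B_eq
  have e : exp τ * F.osc τ ^ 2 = 2 * F.nE τ := by
    have := exp_pos (-τ/2)
    rw [sq_osc, (exp_eq τ).1]; field_simp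
  rw [e] at h1
  have h2 := mul_le_mul (by linarith [h.nE_le] : 2 * F.nE τ ≤ 32) h.exp_osc_le (exp_pos _).le
    (by norm_num)
  linarith [h.abs_A_le]

theorem abs_Λ_le (h : F.Regime τ) : |F.Λ τ| ≤ 65 * exp (-τ/2) ^ 4 := by
  have e : exp τ * F.osc τ ^ 2 = 2 * F.nE τ := by
    have := exp_pos (-τ/2)
    rw [sq_osc, (exp_eq τ).1]; field_simp
  have h2 := F.abs_vir_sub_le τ
  rw [e] at h2
  rw [Λ_eq, abs_mul, abs_of_pos (by positivity), (exp_eq τ).2.2]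
  have h3 := (abs_sub (F.vir τ - circleMean (F.V τ) * F.mom τ) (F.mom τ)).trans
    (add_le_add h2 h.abs_mom_le)
  have h4 : 2 * F.nE τ + 97 ≤ 130 := by linarith [h.nE_le]
  have := mul_le_mul_of_nonneg_left (h3.trans h4) (by positivity : 0 ≤ 1/2 * exp (-τ/2) ^ 4)
  linarith

theorem exp_mul_Pi_eq (F : T2Flow) (τ : ℝ) :
    exp τ * F.Pi τ = F.nPi τ * (exp (-τ/2) ^ 3)⁻¹ := by
  have := exp_pos (-τ/2)
  rw [Pi_eq, (exp_eq τ).1]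
  field_simp

theorem abs_exp_mul_Λ_le (h : F.Regime τ) : |exp τ * F.Pi τ * F.Λ τ| ≤ 200 * exp (-τ/2) := by
  have hd := exp_pos (-τ/2)
  have h2 : 0 ≤ exp τ * F.Pi τ := mul_nonneg (exp_pos _).le (F.Pi_pos τ).le
  rw [abs_mul, abs_of_nonneg h2]
  refine (mul_le_mul_of_nonneg_left h.abs_Λ_le h2).trans ?_
  have : exp τ * F.Pi τ * (65 * exp (-τ/2) ^ 4) = F.nPi τ * (65 * exp (-τ/2)) := by
    rw [exp_mul_Pi_eq]; field_simp
  rw [this]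
  nlinarith [h.nPi_le]

theorem nH_sub_nE (F : T2Flow) (τ : ℝ) : F.nH τ - F.nE τ = exp τ * F.Pi τ * F.Λ τ := by
  rw [nH, nE, H]; ring

theorem abs_nH_sub_nE_le (h : F.Regime τ) : |F.nH τ - F.nE τ| ≤ 200 * exp (-τ/2) := by
  rw [nH_sub_nE]; exact h.abs_exp_mul_Λ_le

theorem abs_circleMean_Vτ_le (h : F.Regime τ) : |circleMean (F.Vτ τ)| * exp (-τ/2)
    ≤ 12 * √(∫ θ in (0:ℝ)..1, exp (-F.ρ τ θ)) * exp (-τ/4) := by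
  have hd := exp_pos (-τ/2)
  have hI : 0 ≤ ∫ θ in (0:ℝ)..1, exp (-F.ρ τ θ) :=
    integral_nonneg zero_le_one fun _ _ => (exp_pos _).le
  have e1 : exp (2*τ) * F.E τ * exp (-τ/2) ^ 2 = F.nE τ / F.nPi τ * exp (-τ/2) := by
    have := F.nPi_pos τ
    rw [E_eq, (exp_eq τ).2.1]; field_simp
  have e2 : exp (-τ/4) ^ 2 = exp (-τ/2) := by
    rw [← exp_nat_mul]; congr 1; push_cast; ring
  refine (abs_le_of_sq_le_sq' ?_ (by positivity)).2
  rw [mul_pow, mul_pow, mul_pow, sq_sqrt hI, sq_abs, e2]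
  have h1 := mul_le_mul_of_nonneg_right (F.sq_circleMean_Vτ_le τ) (pow_pos hd 2).le
  refine h1.trans ?_
  have h3 : (∫ θ in (0:ℝ)..1, exp (-F.ρ τ θ)) * (2 * (exp (2*τ) * F.E τ)) * exp (-τ/2) ^ 2
      = (∫ θ in (0:ℝ)..1, exp (-F.ρ τ θ)) * exp (-τ/2) * (2 * (F.nE τ / F.nPi τ)) := by
    linear_combination 2 * (∫ θ in (0:ℝ)..1, exp (-F.ρ τ θ)) * e1
  rw [h3]
  have := mul_le_mul_of_nonneg_left (by linarith [h.nE_div_le] : 2 * (F.nE τ / F.nPi τ) ≤ 144)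
    (mul_nonneg hI hd.le)
  linarith

theorem abs_nH'_le (hF : F.IsEinsteinFlow) (h : F.Regime τ) :
    |F.nH' τ| ≤ 3400 * exp (-τ/2)
      + 1800 * √(∫ θ in (0:ℝ)..1, exp (-F.ρ τ θ)) * exp (-τ/4) := by
  have hd := exp_pos (-τ/2)
  have hr := F.rate_pos τ
  have e : F.nH' τ = -(1 - F.rate τ) * (exp τ * F.Pi τ * F.Λ τ) - F.nGap τ
      + 1/2 * F.nPi τ * (exp (-τ/2) * (∫ θ in (0:ℝ)..1,
        (F.V τ θ - circleMean (F.V τ)) * (F.T₃ τ θ - F.T₄ τ θ)))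
      - 1/2 * F.nPi τ * (exp (-τ/2) * (circleMean (F.Vτ τ) * F.mom τ)) := by
    have : exp τ * F.Pi τ * exp (-2*τ) = F.nPi τ * exp (-τ/2) := by
      rw [exp_mul_Pi_eq, (exp_eq τ).2.2]; field_simp
    rw [nH', errV, nGap]
    linear_combination 1/2 * ((∫ θ in (0:ℝ)..1,
      (F.V τ θ - circleMean (F.V τ)) * (F.T₃ τ θ - F.T₄ τ θ)) - circleMean (F.Vτ τ) * F.mom τ)
        * this
  have b1 : |-(1 - F.rate τ) * (exp τ * F.Pi τ * F.Λ τ)| ≤ 200 * exp (-τ/2) := by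
    rw [abs_mul]
    refine (mul_le_of_le_one_left (abs_nonneg _) ?_).trans h.abs_exp_mul_Λ_le
    rw [abs_neg, abs_le]; constructor <;> linarith [h.rate_le]
  have b2 := abs_nGap_le hF h
  have hP : 0 ≤ 1/2 * F.nPi τ := by linarith [F.nPi_pos τ]
  have hP' : 1/2 * F.nPi τ ≤ 3/2 := by linarith [h.nPi_le]
  have b3 : |1/2 * F.nPi τ * (exp (-τ/2) * (∫ θ in (0:ℝ)..1,
        (F.V τ θ - circleMean (F.V τ)) * (F.T₃ τ θ - F.T₄ τ θ)))| ≤ 1152 * exp (-τ/2) := by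
    rw [abs_mul, abs_of_nonneg hP]
    refine (mul_le_mul hP' (?_ : _ ≤ 768 * exp (-τ/2)) (abs_nonneg _) (by norm_num)).trans
      (by linarith)
    rw [abs_mul, abs_of_pos hd]
    refine (mul_le_mul_of_nonneg_left (F.abs_integral_V_le τ) hd.le).trans ?_
    have e1 : exp (2*τ) * F.E τ * exp (-τ/2) = F.nE τ / F.nPi τ := by
      have := F.nPi_pos τ
      rw [E_eq, (exp_eq τ).2.1]; field_simp
    have e2 : exp (-τ/2) * (F.osc τ * (2 * (exp (2*τ) * F.E τ)))
        = F.osc τ * (2 * (F.nE τ / F.nPi τ)) := by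
      linear_combination 2 * F.osc τ * e1
    rw [e2]
    have := mul_le_mul h.osc_le (by linarith [h.nE_div_le] : 2 * (F.nE τ / F.nPi τ) ≤ 128)
      (by have := div_nonneg (F.nE_nonneg τ) (F.nPi_pos τ).le; positivity) (by positivity)
    linarith
  have b4 : |1/2 * F.nPi τ * (exp (-τ/2) * (circleMean (F.Vτ τ) * F.mom τ))|
      ≤ 1800 * √(∫ θ in (0:ℝ)..1, exp (-F.ρ τ θ)) * exp (-τ/4) := by
    rw [abs_mul, abs_of_nonneg hP]
    have h1 := mul_le_mul h.abs_circleMean_Vτ_le h.abs_mom_le (abs_nonneg _) (by positivity)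
    have e1 : |exp (-τ/2) * (circleMean (F.Vτ τ) * F.mom τ)|
        = |circleMean (F.Vτ τ)| * exp (-τ/2) * |F.mom τ| := by
      rw [abs_mul, abs_mul, abs_of_pos hd]; ring
    have h2 := mul_le_mul hP' (e1.le.trans h1) (abs_nonneg _) (by norm_num)
    refine h2.trans ?_
    have : 0 ≤ √(∫ θ in (0:ℝ)..1, exp (-F.ρ τ θ)) * exp (-τ/4) := by positivity
    linarith
  rw [abs_le] at b1 b2 b3 b4
  rw [e, abs_le]
  constructor <;> linarith

end Regime

end T2Flow

theorem le_of_hasDerivAt_nonpos {f f' : ℝ → ℝ} {a b : ℝ} (hab : a ≤ b)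
    (h : ∀ t ∈ Set.Icc a b, HasDerivAt f (f' t) t) (h' : ∀ t ∈ Set.Icc a b, f' t ≤ 0) :
    f b ≤ f a := by
  refine antitoneOn_of_deriv_nonpos (convex_Icc a b)
    (fun t ht => (h t ht).continuousAt.continuousWithinAt)
    (fun t ht => (h t (interior_subset ht)).differentiableAt.differentiableWithinAt)
    (fun t ht => ?_) (Set.left_mem_Icc.2 hab) (Set.right_mem_Icc.2 hab) hab
  rw [(h t (interior_subset ht)).deriv]
  exact h' t (interior_subset ht)

theorem hasDerivAt_exp_neg_div (k t : ℝ) :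
    HasDerivAt (fun s : ℝ => exp (-s/k)) (-(exp (-t/k) / k)) t := by
  refine (((hasDerivAt_id t).neg).div_const k).exp.congr_deriv ?_
  simp only [Pi.neg_apply, id]
  ring

theorem abs_sub_le_of_deriv_le_exp {f f' : ℝ → ℝ} {a b C k : ℝ} (hab : a ≤ b) (hk : 0 < k)
    (h : ∀ t ∈ Set.Icc a b, HasDerivAt f (f' t) t)
    (h' : ∀ t ∈ Set.Icc a b, |f' t| ≤ C * exp (-t/k)) :
    |f b - f a| ≤ C * k * (exp (-a/k) - exp (-b/k)) := by
  have e : ∀ t : ℝ, C * k * (exp (-t/k) / k) = C * exp (-t/k) := fun t => by field_simp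
  have h1 := le_of_hasDerivAt_nonpos hab
    (fun t ht => (h t ht).add ((hasDerivAt_exp_neg_div k t).const_mul (C * k))) (fun t ht => by
      have := (abs_le.1 (h' t ht)).2
      have := e t
      linarith)
  have h2 := le_of_hasDerivAt_nonpos hab
    (fun t ht => ((hasDerivAt_exp_neg_div k t).const_mul (C * k)).sub (h t ht)) (fun t ht => by
      have := (abs_le.1 (h' t ht)).1
      have := e t
      linarith)
  simp only [Pi.add_apply, Pi.sub_apply] at h1 h2
  rw [abs_le]
  constructor <;> linarith

theorem exists_limit_of_deriv_le_exp {f f' : ℝ → ℝ} {a C k : ℝ} (hk : 0 < k)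
    (h : ∀ t, a ≤ t → HasDerivAt f (f' t) t)
    (h' : ∀ t, a ≤ t → |f' t| ≤ C * exp (-t/k)) :
    ∃ L, ∀ t, a ≤ t → |f t - L| ≤ C * k * exp (-t/k) := by
  have key : ∀ s t, a ≤ s → a ≤ t →
      f s - C * k * exp (-s/k) ≤ f t + C * k * exp (-t/k) := by
    have hC : 0 ≤ C * k := by
      have := (abs_nonneg _).trans (h' a le_rfl)
      exact mul_nonneg (nonneg_of_mul_nonneg_left this (exp_pos _)) hk.le
    intro s t hs ht
    have p1 := mul_nonneg hC (exp_pos (-s/k)).le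
    have p2 := mul_nonneg hC (exp_pos (-t/k)).le
    rcases le_total s t with hst | hst
    · have := abs_le.1 (abs_sub_le_of_deriv_le_exp hst hk (fun u hu => h u (hs.trans hu.1))
        (fun u hu => h' u (hs.trans hu.1)))
      linarith [this.1]
    · have := abs_le.1 (abs_sub_le_of_deriv_le_exp hst hk (fun u hu => h u (ht.trans hu.1))
        (fun u hu => h' u (ht.trans hu.1)))
      linarith [this.2]
  refine ⟨sSup ((fun s => f s - C * k * exp (-s/k)) '' Set.Ici a), fun t ht => ?_⟩
  have h1 : sSup ((fun s => f s - C * k * exp (-s/k)) '' Set.Ici a)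
      ≤ f t + C * k * exp (-t/k) := by
    refine csSup_le ⟨_, a, Set.self_mem_Ici, rfl⟩ ?_
    rintro _ ⟨s, hs, rfl⟩
    exact key s t hs ht
  have h2 : f t - C * k * exp (-t/k)
      ≤ sSup ((fun s => f s - C * k * exp (-s/k)) '' Set.Ici a) := by
    refine le_csSup ⟨f a + C * k * exp (-a/k), ?_⟩ ⟨t, ht, rfl⟩
    rintro _ ⟨s, hs, rfl⟩
    exact key s a hs le_rfl
  rw [abs_le]
  constructor <;> linarith

/-- Continuous induction: a strict bound that is implied by its weak form persists. -/
theorem neg_of_bootstrap {φ : ℝ → ℝ} (hφ : Continuous φ) {a : ℝ} (h0 : φ a < 0)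
    (h : ∀ t, a ≤ t → (∀ u ∈ Set.Icc a t, φ u ≤ 0) → φ t < 0) {t : ℝ} (ht : a ≤ t) :
    φ t < 0 := by
  by_contra! hc
  have hne : ({u ∈ Set.Icc a t | φ u = 0}).Nonempty := by
    obtain ⟨u, hu, hu0⟩ := intermediate_value_Icc ht hφ.continuousOn ⟨h0.le, hc⟩
    exact ⟨u, hu, hu0⟩
  have hcl : IsCompact {u ∈ Set.Icc a t | φ u = 0} :=
    isCompact_Icc.inter_right (isClosed_singleton.preimage hφ)
  obtain ⟨m, ⟨hm, hm0⟩, hmin⟩ := hcl.exists_isLeast hne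
  refine (h m hm.1 fun u hu => ?_).ne hm0
  by_contra! hpos
  obtain ⟨v, hv, hv0⟩ := intermediate_value_Icc hu.1 hφ.continuousOn ⟨h0.le, hpos.le⟩
  have h1 := hmin ⟨⟨hv.1, hv.2.trans (hu.2.trans hm.2)⟩, hv0⟩
  have h2 : u = m := le_antisymm hu.2 (h1.trans hv.2)
  rw [h2, hm0] at hpos
  exact hpos.false

/-- The Lyapunov function of the linearized system. -/
def lyapunov (c d : ℝ) : ℝ := (d - c/4)^2 + 39/16 * c^2

theorem lyapunov_nonneg (c d : ℝ) : 0 ≤ lyapunov c d := by unfold lyapunov; positivity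

/-- Consequences of smallness of the Lyapunov function. -/
theorem lyapunov_bounds {c d : ℝ} :
    |d - c/4| ≤ √(lyapunov c d) ∧ |c| ≤ 13/20 * √(lyapunov c d) ∧
      |d| ≤ 6/5 * √(lyapunov c d) := by
  have hs := sq_sqrt (lyapunov_nonneg c d)
  have hs0 := sqrt_nonneg (lyapunov c d)
  set s := √(lyapunov c d)
  unfold lyapunov at hs
  have h1 : |d - c/4| ≤ s := abs_le_of_sq_le_sq (by nlinarith) hs0
  have h2 : |c| ≤ 13/20 * s := abs_le_of_sq_le_sq (by nlinarith) (by positivity)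
  refine ⟨h1, h2, ?_⟩
  rw [abs_le] at *
  constructor <;> linarith [h1.1, h1.2, h2.1, h2.2]

theorem inv_sqrt_ten_bounds : 79/250 < 1 / √10 ∧ 1 / √10 < 317/1000 ∧ (1 / √10) ^ 2 = 1/10 := by
  have h : (1 / √10) ^ 2 = (1/10 : ℝ) := by
    rw [div_pow, sq_sqrt (by norm_num)]; norm_num
  have h0 : 0 < 1 / √(10:ℝ) := by positivity
  exact ⟨by nlinarith, by nlinarith, h⟩

/-- The differential inequality satisfied by the Lyapunov function. -/
theorem lyapunov_deriv_le {r c d f₁ f₂ : ℝ} (hr1 : 79/250 < r) (hr2 : r < 317/1000)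
    (hr : r ^ 2 = 1/10) (hq : lyapunov c d ≤ 1/10^6) :
    2 * (d - c/4) * (((d + r) / (c + 2*r)^2 - 5/2 * (d + r) + f₂)
        - ((d + r) - (c + 2*r)/2 + f₁)/4)
      + 39/8 * c * ((d + r) - (c + 2*r)/2 + f₁)
    ≤ -(lyapunov c d)/2 + 40 * √(lyapunov c d) * lyapunov c d
      + 6 * √(lyapunov c d) * (|f₁| + |f₂|) := by
  obtain ⟨b1, b2, b3⟩ := lyapunov_bounds (c := c) (d := d)
  have hs := sq_sqrt (lyapunov_nonneg c d)
  have hs0 := sqrt_nonneg (lyapunov c d)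
  have hs1 : √(lyapunov c d) ≤ 1/1000 := by
    rw [sqrt_le_left (by norm_num)]; exact hq.trans (by norm_num)
  have hdef : lyapunov c d = (d - c/4)^2 + 39/16 * c^2 := rfl
  set s := √(lyapunov c d)
  have hx : 3/5 < c + 2*r := by have := (abs_le.1 b2).1; linarith
  set N := 15/2*r*c^2 - 10*r*(c*d) - 5/2*(c^2*d) + 5/2*c^3 with hN
  have hn : (d + r) / (c + 2*r)^2 - 5/2 * (d + r) = -5/2*c + N / (c + 2*r)^2 := by
    have h0 : (c + 2*r)^2 ≠ 0 := by positivity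
    have h1 : d + r = (-5/2*c + 5/2*(d + r)) * (c + 2*r)^2 + N := by
      rw [hN]; linear_combination (-10*(d + r)) * hr
    have h2 : (d + r) / (c + 2*r)^2 = (-5/2*c + 5/2*(d + r)) + N / (c + 2*r)^2 := by
      rw [div_eq_iff h0, add_mul, div_mul_cancel₀ _ h0]; exact h1
    rw [h2]; ring
  have hNb : |N| ≤ 7 * s^2 := by
    have c2 : c^2 ≤ (13/20*s)^2 := by rw [← sq_abs]; gcongr
    have cd : |c*d| ≤ 13/20*s*(6/5*s) := by rw [abs_mul]; gcongr
    have c2d : |c^2*d| ≤ (13/20*s)^2*(6/5*s) := by rw [abs_mul, abs_of_nonneg (sq_nonneg c)]; gcongr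
    have c3 : |c^3| ≤ (13/20*s)^3 := by rw [abs_pow]; gcongr
    have s3 : s^3 ≤ s^2 := by nlinarith [sq_nonneg s]
    have t1 : |r*(c*d)| ≤ 317/1000 * (13/20*s*(6/5*s)) := by
      rw [abs_mul, abs_of_nonneg (by linarith : 0 ≤ r)]; gcongr
    have t2 : r*c^2 ≤ 317/1000*(13/20*s)^2 := by gcongr
    have t3 : 0 ≤ r*c^2 := by positivity
    rw [abs_le] at cd c2d c3 t1 ⊢
    constructor <;> nlinarith [sq_nonneg s]
  have hnb : |N / (c + 2*r)^2| ≤ 20 * s^2 := by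
    rw [abs_div, abs_of_pos (by positivity : 0 < (c + 2*r)^2), div_le_iff₀ (by positivity)]
    have : 9/25 ≤ (c + 2*r)^2 := by nlinarith
    nlinarith [mul_le_mul_of_nonneg_left this (by positivity : 0 ≤ 20 * s^2), sq_nonneg s]
  set n := N / (c + 2*r)^2
  have e : 2 * (d - c/4) * (((d + r) / (c + 2*r)^2 - 5/2 * (d + r) + f₂)
        - ((d + r) - (c + 2*r)/2 + f₁)/4)
      + 39/8 * c * ((d + r) - (c + 2*r)/2 + f₁)
      = -(lyapunov c d)/2 + 2 * ((d - c/4) * n) + 2 * ((d - c/4) * f₂)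
        - 1/2 * ((d - c/4) * f₁) + 39/8 * (c * f₁) := by
    rw [hn, hdef]; ring
  have m1 : (d - c/4) * n ≤ s * (20 * s^2) := by
    refine (le_abs_self _).trans ?_
    rw [abs_mul]; gcongr
  have m2 : (d - c/4) * f₂ ≤ s * |f₂| := by
    refine (le_abs_self _).trans ?_
    rw [abs_mul]; gcongr
  have m3 : -(s * |f₁|) ≤ (d - c/4) * f₁ := by
    refine neg_le_of_abs_le ?_
    rw [abs_mul]; gcongr
  have m4 : c * f₁ ≤ 13/20 * s * |f₁| := by
    refine (le_abs_self _).trans ?_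
    rw [abs_mul]; gcongr
  have m5 : 0 ≤ s * |f₂| := by positivity
  have m6 : 0 ≤ s * |f₁| := by positivity
  rw [e, ← hs]
  linarith

namespace T2Flow

section

variable (F : T2Flow)

theorem sqrt_nH (τ : ℝ) : √(F.nH τ) = exp (τ/2) * √(F.H τ) := by
  rw [nH, sqrt_mul (exp_pos τ).le, exp_half]

theorem c_eq (τ : ℝ) : F.c τ = F.nPi τ / √(F.nH τ) - 2 * (1 / √10) := by
  obtain ⟨e1, -, -, e4, -, -⟩ := exp_powers τ
  have := exp_pos (τ/2)
  rw [c, nPi, sqrt_nH, e1, e4]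
  congr 1
  · field_simp
  · ring

theorem d_eq (τ : ℝ) : F.d τ = F.nY τ / √(F.nH τ) - 1 / √10 := by
  have e : exp (3*τ) = exp (τ/2) ^ 6 := by rw [← exp_nat_mul]; congr 1; push_cast; ring
  obtain ⟨-, -, -, -, e5, -⟩ := exp_powers τ
  have := exp_pos (τ/2)
  rw [d, nY, sqrt_nH, e, e5]
  congr 1
  field_simp

/-- The error in the equation for `c`. -/
def errc (τ : ℝ) : ℝ := -(F.nH' τ / F.nH τ) * (F.c τ + 2 * (1 / √10)) / 2

/-- The error in the equation for `d`. -/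
def errd (τ : ℝ) : ℝ :=
  (F.d τ + 1 / √10) * ((F.nE τ - F.nH τ) / F.nH τ) / (F.c τ + 2 * (1 / √10)) ^ 2
    + F.nGap τ / ((F.c τ + 2 * (1 / √10)) * F.nH τ)
    - (F.nH' τ / F.nH τ) * (F.d τ + 1 / √10) / 2

end

variable {F : T2Flow} {τ : ℝ}

theorem IsEinsteinFlow.hasDerivAt_c (hF : F.IsEinsteinFlow) (hG : 0 < F.nH τ) :
    HasDerivAt F.c ((F.d τ + 1 / √10) - (F.c τ + 2 * (1 / √10)) / 2 + F.errc τ) τ := by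
  have h := ((hF.hasDerivAt_nPi τ).div ((hF.hasDerivAt_nH τ).sqrt hG.ne')
    (sqrt_pos.2 hG).ne').sub_const (2 * (1 / √10))
  have e : F.c = fun s => (F.nPi / fun y => √(F.nH y)) s - 2 * (1 / √10) := by
    funext s; exact F.c_eq s
  rw [← e] at h
  refine h.congr_deriv ?_
  have hs := sqrt_pos.2 hG
  have hsq : F.nH τ = √(F.nH τ) ^ 2 := (sq_sqrt hG.le).symm
  rw [errc, c_eq, d_eq, sub_add_cancel, sub_add_cancel]
  generalize √(F.nH τ) = s at *
  rw [hsq]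
  field_simp
  ring

theorem IsEinsteinFlow.hasDerivAt_d (hF : F.IsEinsteinFlow) (hG : 0 < F.nH τ) :
    HasDerivAt F.d ((F.d τ + 1 / √10) / (F.c τ + 2 * (1 / √10)) ^ 2
      - 5/2 * (F.d τ + 1 / √10) + F.errd τ) τ := by
  have h := ((hF.hasDerivAt_nY τ).div ((hF.hasDerivAt_nH τ).sqrt hG.ne')
    (sqrt_pos.2 hG).ne').sub_const (1 / √10)
  have e : F.d = fun s => (F.nY / fun y => √(F.nH y)) s - 1 / √10 := by
    funext s; exact F.d_eq s
  rw [← e] at h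
  refine h.congr_deriv ?_
  have hs := sqrt_pos.2 hG
  have hP := F.nPi_pos τ
  have hsq : F.nH τ = √(F.nH τ) ^ 2 := (sq_sqrt hG.le).symm
  rw [errd, c_eq, d_eq, sub_add_cancel, sub_add_cancel]
  generalize √(F.nH τ) = s at *
  rw [hsq]
  field_simp
  ring

/-- The Lyapunov function along the flow. -/
def lyap (F : T2Flow) (τ : ℝ) : ℝ := lyapunov (F.c τ) (F.d τ)

theorem lyap_nonneg (F : T2Flow) (τ : ℝ) : 0 ≤ F.lyap τ := lyapunov_nonneg _ _

/-- The derivative of `lyap`. -/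
def lyap' (F : T2Flow) (τ : ℝ) : ℝ :=
  2 * (F.d τ - F.c τ/4) * (((F.d τ + 1 / √10) / (F.c τ + 2*(1 / √10))^2
      - 5/2 * (F.d τ + 1 / √10) + F.errd τ)
        - ((F.d τ + 1 / √10) - (F.c τ + 2*(1 / √10))/2 + F.errc τ)/4)
      + 39/8 * F.c τ * ((F.d τ + 1 / √10) - (F.c τ + 2*(1 / √10))/2 + F.errc τ)

theorem IsEinsteinFlow.hasDerivAt_lyap (hF : F.IsEinsteinFlow) (hG : 0 < F.nH τ) :
    HasDerivAt F.lyap (F.lyap' τ) τ := by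
  have hc := hF.hasDerivAt_c hG
  have hd := hF.hasDerivAt_d hG
  refine (((hd.sub (hc.div_const 4)).pow 2).add ((hc.pow 2).const_mul (39/16))).congr_deriv ?_
  rw [lyap']
  simp only [Pi.sub_apply]
  push_cast
  ring

/-- The bootstrap assumptions. -/
structure Good (F : T2Flow) (τ : ℝ) : Prop where
  le_nH : 1/4 ≤ F.nH τ
  nH_le : F.nH τ ≤ 8
  nE_le : F.nE τ ≤ 2 * F.nH τ
  lyap_le : F.lyap τ ≤ 1/10^6

namespace Good

theorem nH_pos (h : F.Good τ) : 0 < F.nH τ := by linarith [h.le_nH]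

theorem bounds (h : F.Good τ) : (631/1000 < F.c τ + 2 * (1 / √10) ∧
    F.c τ + 2 * (1 / √10) < 635/1000) ∧ 314/1000 < F.d τ + 1 / √10 ∧
    F.d τ + 1 / √10 < 319/1000 := by
  obtain ⟨-, b2, b3⟩ := lyapunov_bounds (c := F.c τ) (d := F.d τ)
  obtain ⟨r1, r2, -⟩ := inv_sqrt_ten_bounds
  have hs1 : √(lyapunov (F.c τ) (F.d τ)) ≤ 1/1000 := by
    rw [sqrt_le_left (by norm_num)]; exact h.lyap_le.trans (by norm_num)
  rw [abs_le] at b2 b3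
  refine ⟨⟨?_, ?_⟩, ?_, ?_⟩ <;> linarith [b2.1, b2.2, b3.1, b3.2]

theorem sqrt_bounds (h : F.Good τ) : 1/2 ≤ √(F.nH τ) ∧ √(F.nH τ) ≤ 3 := by
  constructor
  · exact le_sqrt_of_sq_le (by linarith [h.le_nH])
  · rw [sqrt_le_left (by norm_num)]; linarith [h.nH_le]

theorem nPi_eq (h : F.Good τ) : F.nPi τ = (F.c τ + 2 * (1 / √10)) * √(F.nH τ) := by
  rw [c_eq, sub_add_cancel, div_mul_cancel₀ _ (sqrt_pos.2 h.nH_pos).ne']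

theorem nY_eq (h : F.Good τ) : F.nY τ = (F.d τ + 1 / √10) * √(F.nH τ) := by
  rw [d_eq, sub_add_cancel, div_mul_cancel₀ _ (sqrt_pos.2 h.nH_pos).ne']

theorem rate_eq (h : F.Good τ) :
    F.rate τ = (F.d τ + 1 / √10) / (F.c τ + 2 * (1 / √10)) := by
  have h1 := F.nY_eq τ
  rw [h.nY_eq, h.nPi_eq] at h1
  have hs := sqrt_pos.2 h.nH_pos
  rw [eq_div_iff (by linarith [h.bounds.1.1])]
  refine (mul_right_cancel₀ hs.ne' ?_).symm
  rw [h1]; ring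

theorem regime (h : F.Good τ) (hA : |F.A τ| ≤ 1) (hB : F.B τ = 0)
    (hδ : exp (-τ/4) ≤ 1/10^10) : F.Regime τ := by
  obtain ⟨⟨x1, x2⟩, y1, y2⟩ := h.bounds
  obtain ⟨s1, s2⟩ := h.sqrt_bounds
  refine ⟨by linarith [h.nE_le, h.nH_le], ?_, ?_, ?_, hA, hB, ?_⟩
  · rw [h.nPi_eq]; nlinarith
  · rw [h.nPi_eq]; nlinarith
  · rw [h.rate_eq, div_le_one (by linarith)]; linarith
  · have : exp (-τ/2) = exp (-τ/4) ^ 2 := by rw [← exp_nat_mul]; congr 1; push_cast; ring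
    rw [this]
    nlinarith [exp_pos (-τ/4)]

theorem err_le (hF : F.IsEinsteinFlow) (h : F.Good τ) (hR : F.Regime τ) :
    |F.errc τ| + |F.errd τ| ≤ 2 * |F.nH' τ| + 14000 * exp (-τ/2) := by
  obtain ⟨⟨x1, x2⟩, y1, y2⟩ := h.bounds
  have hG := h.nH_pos
  have hη : |F.nH' τ / F.nH τ| ≤ 4 * |F.nH' τ| := by
    rw [abs_div, abs_of_pos hG, div_le_iff₀ hG]
    nlinarith [h.le_nH, abs_nonneg (F.nH' τ)]
  have hW : |(F.nE τ - F.nH τ) / F.nH τ| ≤ 800 * exp (-τ/2) := by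
    rw [abs_div, abs_of_pos hG, div_le_iff₀ hG, abs_sub_comm]
    nlinarith [h.le_nH, hR.abs_nH_sub_nE_le, exp_pos (-τ/2)]
  have hD := hR.abs_nGap_le hF
  unfold errc errd
  generalize F.c τ + 2 * (1 / √10) = x at *
  generalize F.d τ + 1 / √10 = y at *
  have t1 : |-(F.nH' τ / F.nH τ) * x / 2| ≤ 13/10 * |F.nH' τ| := by
    rw [abs_div, abs_mul, abs_neg, abs_of_pos (by linarith : 0 < x), abs_two]
    nlinarith [abs_nonneg (F.nH' τ / F.nH τ)]
  have t2 : |F.nH' τ / F.nH τ * y / 2| ≤ 7/10 * |F.nH' τ| := by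
    rw [abs_div, abs_mul, abs_of_pos (by linarith : 0 < y), abs_two]
    nlinarith [abs_nonneg (F.nH' τ / F.nH τ)]
  have t3 : |y * ((F.nE τ - F.nH τ) / F.nH τ) / x ^ 2| ≤ 800 * exp (-τ/2) := by
    rw [abs_div, abs_mul, abs_of_pos (by linarith : 0 < y), abs_of_pos (by positivity : 0 < x^2),
      div_le_iff₀ (by positivity)]
    have : y ≤ x^2 := by nlinarith
    nlinarith [abs_nonneg ((F.nE τ - F.nH τ) / F.nH τ), exp_pos (-τ/2)]
  have t4 : |F.nGap τ / (x * F.nH τ)| ≤ 13200 * exp (-τ/2) := by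
    have hx : 631/4000 ≤ x * F.nH τ := by nlinarith [h.le_nH]
    rw [abs_div, abs_of_pos (by linarith : 0 < x * F.nH τ), div_le_iff₀ (by linarith)]
    nlinarith [exp_pos (-τ/2)]
  have t5 := abs_sub (y * ((F.nE τ - F.nH τ) / F.nH τ) / x ^ 2 + F.nGap τ / (x * F.nH τ))
    (F.nH' τ / F.nH τ * y / 2)
  have t6 := abs_add_le (y * ((F.nE τ - F.nH τ) / F.nH τ) / x ^ 2) (F.nGap τ / (x * F.nH τ))
  linarith

theorem lyap'_le (h : F.Good τ) : F.lyap' τ ≤ -(F.lyap τ)/2 + 40 * √(F.lyap τ) * F.lyap τ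
      + 6 * √(F.lyap τ) * (|F.errc τ| + |F.errd τ|) := by
  obtain ⟨r1, r2, r3⟩ := inv_sqrt_ten_bounds
  exact lyapunov_deriv_le r1 r2 r3 h.lyap_le

theorem sqrt_lyap_le (h : F.Good τ) : √(F.lyap τ) ≤ 1/1000 := by
  rw [sqrt_le_left (by norm_num)]; exact h.lyap_le.trans (by norm_num)

theorem lyap'_le_sq (h : F.Good τ) :
    F.lyap' τ ≤ -(F.lyap τ)/8 + 200 * (|F.errc τ| + |F.errd τ|) ^ 2 := by
  have h1 := h.lyap'_le
  have h2 := h.sqrt_lyap_le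
  have h3 := sq_sqrt (F.lyap_nonneg τ)
  have h4 := F.lyap_nonneg τ
  set s := √(F.lyap τ)
  nlinarith [sq_nonneg (s - 20 * (|F.errc τ| + |F.errd τ|)),
    mul_le_mul_of_nonneg_right h2 h4, sq_nonneg (|F.errc τ| + |F.errd τ|)]

end Good

end T2Flow

namespace T2Flow

variable {F : T2Flow} {s₀ : ℝ}

theorem IsEinsteinFlow.ρ_mono (hF : F.IsEinsteinFlow) (θ : ℝ) {s t : ℝ} (hst : s ≤ t) :
    F.ρ s θ ≤ F.ρ t θ := by
  have := le_of_hasDerivAt_nonpos hst (fun u _ => (hF.hasDerivAt_ρ u θ).neg)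
    (fun u _ => neg_nonpos.2 (exp_pos _).le)
  simpa using this

theorem integral_exp_neg_ρ_le {τ : ℝ} (h : ∀ θ, 0 ≤ F.ρ τ θ) :
    ∫ θ in (0:ℝ)..1, exp (-F.ρ τ θ) ≤ 1 := by
  have := integral_mono (μ := volume) zero_le_one (F.sρ.neg.exp.intervalIntegrable τ 0 1)
    (intervalIntegrable_const (c := (1:ℝ))) fun θ => exp_le_one_iff.2 (neg_nonpos.2 (h θ))
  simpa using this

theorem IsEinsteinFlow.continuous_nE (hF : F.IsEinsteinFlow) : Continuous F.nE := by
  have hK : Continuous F.K := continuous_iff_continuousAt.2 fun t => (hF.hasDerivAt_K t).continuousAt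
  have hP : Continuous F.Pi :=
    continuous_iff_continuousAt.2 fun t => (hF.hasDerivAt_Pi t).continuousAt
  have e : F.nE = fun t => exp t * (F.Pi t * (exp (-2*t) * F.K t)) := by
    funext t; rw [nE, T2Flow.E_eq]
  rw [e]
  fun_prop

/-- A continuous function whose sign detects the bootstrap assumptions. -/
def gauge (F : T2Flow) (τ : ℝ) : ℝ :=
  max (max (1/4 - F.nH τ) (F.nH τ - 8)) (max (F.nE τ - 2 * F.nH τ)
    (lyapunov (F.nPi τ / √(max (F.nH τ) (1/4)) - 2 * (1 / √10))
      (F.nY τ / √(max (F.nH τ) (1/4)) - 1 / √10) - 1/10^6))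

theorem IsEinsteinFlow.continuous_gauge (hF : F.IsEinsteinFlow) : Continuous F.gauge := by
  have hE := hF.continuous_nE
  have hH : Continuous F.nH :=
    continuous_iff_continuousAt.2 fun t => (hF.hasDerivAt_nH t).continuousAt
  have hP : Continuous F.nPi :=
    continuous_iff_continuousAt.2 fun t => (hF.hasDerivAt_nPi t).continuousAt
  have hY : Continuous F.nY :=
    continuous_iff_continuousAt.2 fun t => (hF.hasDerivAt_nY t).continuousAt
  have hs : Continuous fun t => √(max (F.nH t) (1/4)) := (hH.max continuous_const).sqrt
  have h0 : ∀ t, √(max (F.nH t) (1/4)) ≠ 0 := fun t =>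
    (sqrt_pos.2 (lt_max_of_lt_right (by norm_num))).ne'
  have h1 := hP.div hs h0
  have h2 := hY.div hs h0
  unfold gauge lyapunov
  fun_prop

theorem lyapunov_gauge_eq {τ : ℝ} (h : 1/4 ≤ F.nH τ) :
    lyapunov (F.nPi τ / √(max (F.nH τ) (1/4)) - 2 * (1 / √10))
      (F.nY τ / √(max (F.nH τ) (1/4)) - 1 / √10) = F.lyap τ := by
  rw [max_eq_left h, ← c_eq, ← d_eq, lyap]

theorem good_of_gauge_nonpos {τ : ℝ} (h : F.gauge τ ≤ 0) : F.Good τ := by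
  simp only [gauge, max_le_iff] at h
  obtain ⟨⟨h1, h2⟩, h3, h4⟩ := h
  have h1' : 1/4 ≤ F.nH τ := by linarith
  rw [lyapunov_gauge_eq h1'] at h4
  exact ⟨h1', by linarith, by linarith, by linarith⟩

theorem gauge_neg {τ : ℝ} (h1 : 1/4 < F.nH τ) (h2 : F.nH τ < 8) (h3 : F.nE τ < 2 * F.nH τ)
    (h4 : F.lyap τ < 1/10^6) : F.gauge τ < 0 := by
  simp only [gauge, max_lt_iff, lyapunov_gauge_eq h1.le]
  exact ⟨⟨by linarith, by linarith⟩, by linarith, by linarith⟩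

/-- The hypotheses on the initial data, in normalized form. -/
structure Initial (F : T2Flow) (s₀ : ℝ) : Prop where
  B_eq : ∀ τ, F.B τ = 0
  abs_A_le : |F.A s₀| ≤ 1
  ρ_nonneg : ∀ θ, 0 ≤ F.ρ s₀ θ
  exp_le : exp (-s₀/4) ≤ 1/10^10
  le_nH : 1/2 ≤ F.nH s₀
  nH_le : F.nH s₀ ≤ 4
  nE_lt : F.nE s₀ < 2 * F.nH s₀
  lyap_le : F.lyap s₀ ≤ 1/10^9

namespace Initial

theorem exp_le_of_le (h : F.Initial s₀) {τ : ℝ} (hτ : s₀ ≤ τ) : exp (-τ/4) ≤ 1/10^10 :=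
  (exp_le_exp.2 (by linarith)).trans h.exp_le

theorem regime_of_good (hF : F.IsEinsteinFlow) (h : F.Initial s₀) {τ : ℝ} (hτ : s₀ ≤ τ)
    (hg : F.Good τ) : F.Regime τ := by
  refine hg.regime ?_ (h.B_eq τ) (h.exp_le_of_le hτ)
  rw [hF.A_const τ s₀]; exact h.abs_A_le

theorem exp_half_eq (τ : ℝ) : exp (-τ/2) = exp (-τ/4) ^ 2 := by
  rw [← exp_nat_mul]; congr 1; push_cast; ring

theorem abs_nH'_le (hF : F.IsEinsteinFlow) (h : F.Initial s₀) {τ : ℝ} (hτ : s₀ ≤ τ)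
    (hg : F.Good τ) : |F.nH' τ| ≤ 2000 * exp (-τ/4) := by
  have h1 := (h.regime_of_good hF hτ hg).abs_nH'_le hF
  have hI : √(∫ θ in (0:ℝ)..1, exp (-F.ρ τ θ)) ≤ 1 := by
    rw [sqrt_le_one]
    exact integral_exp_neg_ρ_le fun θ => (h.ρ_nonneg θ).trans (hF.ρ_mono θ hτ)
  have h2 := h.exp_le_of_le hτ
  rw [exp_half_eq] at h1
  nlinarith [exp_pos (-τ/4)]

theorem lyap'_le (hF : F.IsEinsteinFlow) (h : F.Initial s₀) {τ : ℝ} (hτ : s₀ ≤ τ)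
    (hg : F.Good τ) : F.lyap' τ ≤ 5 * 10^9 * exp (-τ/2) := by
  have h1 := hg.lyap'_le_sq
  have h2 := hg.err_le hF (h.regime_of_good hF hτ hg)
  have h3 := h.abs_nH'_le hF hτ hg
  have h4 := h.exp_le_of_le hτ
  have h5 : |F.errc τ| + |F.errd τ| ≤ 5000 * exp (-τ/4) := by
    rw [exp_half_eq] at h2
    nlinarith [exp_pos (-τ/4)]
  have h6 : (|F.errc τ| + |F.errd τ|) ^ 2 ≤ (5000 * exp (-τ/4)) ^ 2 := by gcongr
  rw [exp_half_eq]
  linarith [F.lyap_nonneg τ]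

theorem good (hF : F.IsEinsteinFlow) (h : F.Initial s₀) {τ : ℝ} (hτ : s₀ ≤ τ) : F.Good τ := by
  refine good_of_gauge_nonpos (neg_of_bootstrap hF.continuous_gauge ?_ (fun t ht hu => ?_) hτ).le
  · exact gauge_neg (by linarith [h.le_nH]) (by linarith [h.nH_le]) h.nE_lt
      (h.lyap_le.trans_lt (by norm_num))
  have hg : ∀ u ∈ Set.Icc s₀ t, F.Good u := fun u hu' => good_of_gauge_nonpos (hu u hu')
  have h1 := abs_sub_le_of_deriv_le_exp ht four_pos (fun u _ => hF.hasDerivAt_nH u)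
    (fun u hu' => h.abs_nH'_le hF hu'.1 (hg u hu'))
  have h2 := le_of_hasDerivAt_nonpos ht (fun u hu' => (hF.hasDerivAt_lyap (hg u hu').nH_pos).add
    ((hasDerivAt_exp_neg_div 2 u).const_mul (10^10))) (fun u hu' => by
      linarith [h.lyap'_le hF hu'.1 (hg u hu')])
  simp only [Pi.add_apply] at h2
  have h3 := (h.regime_of_good hF ht (hg t ⟨ht, le_rfl⟩)).abs_nH_sub_nE_le
  have h4 := h.exp_le
  have h5 : exp (-s₀/2) ≤ (1/10^10)^2 := by
    rw [exp_half_eq]; gcongr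
  have h6 : exp (-t/2) ≤ exp (-s₀/2) := exp_le_exp.2 (by linarith)
  rw [abs_le] at h1 h3
  have h7 := exp_pos (-t/4)
  have h8 := exp_pos (-t/2)
  have h9 := h.le_nH
  have h10 := h.nH_le
  refine gauge_neg ?_ ?_ ?_ ?_
  · linarith [h1.1]
  · linarith [h1.2]
  · linarith [h1.1, h3.1]
  · linarith [h.lyap_le]

end Initial

end T2Flow

theorem le_of_forall_le_add_exp {a m L C k : ℝ} (hk : 0 < k)
    (h : ∀ t, a ≤ t → m ≤ L + C * exp (-t/k)) : m ≤ L := by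
  have h1 : Filter.Tendsto (fun t : ℝ => exp (-t/k)) Filter.atTop (nhds 0) :=
    tendsto_exp_atBot.comp (Filter.tendsto_neg_atTop_atBot.atBot_div_const hk)
  have h2 : Filter.Tendsto (fun t : ℝ => L + C * exp (-t/k)) Filter.atTop (nhds (L + C * 0)) :=
    (h1.const_mul C).const_add L
  rw [mul_zero, add_zero] at h2
  exact ge_of_tendsto h2 ((Filter.eventually_ge_atTop a).mono h)

namespace T2Flow

variable {F : T2Flow} {s₀ : ℝ}

theorem IsEinsteinFlow.hasDerivAt_ρ_sub_log (hF : F.IsEinsteinFlow) (τ θ : ℝ) :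
    HasDerivAt (fun s => F.ρ s θ - log (F.Pi s)) (exp (F.l τ θ) - F.rate τ) τ := by
  refine ((hF.hasDerivAt_ρ τ θ).sub ((hF.hasDerivAt_Pi τ).log (F.Pi_pos τ).ne')).congr_deriv ?_
  rw [rate]

namespace Initial

theorem exp_half_le_one (h : F.Initial s₀) {τ : ℝ} (hτ : s₀ ≤ τ) : exp (-τ/2) ≤ 1/1000 := by
  have := h.exp_le_of_le hτ
  rw [exp_half_eq]; nlinarith [exp_pos (-τ/4)]

theorem pos (h : F.Initial s₀) : 0 < s₀ := by
  have h1 : exp (-s₀/4) < 1 := h.exp_le.trans_lt (by norm_num)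
  rw [exp_lt_one_iff] at h1
  linarith

theorem abs_ρ_sub_log_deriv_le (hF : F.IsEinsteinFlow) (h : F.Initial s₀) {τ : ℝ} (hτ : s₀ ≤ τ)
    (θ : ℝ) : |exp (F.l τ θ) - F.rate τ| ≤ 128 * exp (-τ/2) :=
  (h.regime_of_good hF hτ (h.good hF hτ)).abs_exp_l_sub_rate_le hF θ

theorem abs_ρ_sub_log_sub_le (hF : F.IsEinsteinFlow) (h : F.Initial s₀) {τ : ℝ} (hτ : s₀ ≤ τ)
    (θ : ℝ) : |(F.ρ τ θ - log (F.Pi τ)) - (F.ρ s₀ θ - log (F.Pi s₀))| ≤ 1 := by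
  have h1 := abs_sub_le_of_deriv_le_exp hτ two_pos (fun u _ => hF.hasDerivAt_ρ_sub_log u θ)
    (fun u hu => h.abs_ρ_sub_log_deriv_le hF hu.1 θ)
  linarith [exp_pos (-τ/2), h.exp_half_le_one le_rfl]

theorem exists_ρ_limit (hF : F.IsEinsteinFlow) (h : F.Initial s₀) :
    ∃ ρinf : ℝ → ℝ, ∃ C : ℝ, 0 ≤ C ∧ ∀ τ, s₀ ≤ τ → ∀ θ,
      |(F.Pi τ)⁻¹ * exp (F.ρ τ θ) - exp (ρinf θ)| ≤ C * exp (-τ/2) := by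
  have h1 : ∀ θ, ∃ L, ∀ t, s₀ ≤ t →
      |(F.ρ t θ - log (F.Pi t)) - L| ≤ 128 * 2 * exp (-t/2) := fun θ =>
    exists_limit_of_deriv_le_exp two_pos (fun t _ => hF.hasDerivAt_ρ_sub_log t θ)
      (fun t ht => h.abs_ρ_sub_log_deriv_le hF ht θ)
  choose L hL using h1
  obtain ⟨M, hM⟩ : ∃ M, ∀ θ, F.ρ s₀ θ ≤ M := by
    obtain ⟨M, hM⟩ := isCompact_Icc.bddAbove_image
      (K := Set.Icc (0:ℝ) 1) (F.sρ.continuous_right s₀).continuousOn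
    refine ⟨M, fun θ => ?_⟩
    obtain ⟨y, hy, e, -⟩ := exists_mem_Icc_of_periodic (F.periodic_ρ s₀) (F.periodic_ρ s₀) θ
    rw [← e]
    exact hM ⟨y, hy, rfl⟩
  have hLM : ∀ θ, exp (L θ) ≤ exp (M - log (F.Pi s₀) + 1) := fun θ => by
    have h2 := (abs_le.1 (hL θ s₀ le_rfl)).1
    have h3 := h.exp_half_le_one le_rfl
    exact exp_le_exp.2 (by linarith [hM θ])
  refine ⟨L, 512 * exp (M - log (F.Pi s₀) + 1), by positivity, fun τ hτ θ => ?_⟩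
  have e1 : (F.Pi τ)⁻¹ * exp (F.ρ τ θ) = exp (F.ρ τ θ - log (F.Pi τ)) := by
    rw [exp_sub, exp_log (F.Pi_pos τ)]; ring
  have h2 := hL θ τ hτ
  have h3 := h.exp_half_le_one hτ
  have h4 := abs_exp_sub_one_le (h2.trans (by linarith))
  have e2 : exp (F.ρ τ θ - log (F.Pi τ)) - exp (L θ)
      = exp (L θ) * (exp (F.ρ τ θ - log (F.Pi τ) - L θ) - 1) := by
    rw [mul_sub, ← exp_add]; ring_nf
  rw [e1, e2, abs_mul, abs_of_pos (exp_pos _)]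
  refine (mul_le_mul (hLM θ) (h4.trans (mul_le_mul_of_nonneg_left h2 two_pos.le))
    (abs_nonneg _) (exp_pos _).le).trans_eq (by ring)

theorem exists_abs_nH'_le (hF : F.IsEinsteinFlow) (h : F.Initial s₀) :
    ∃ C : ℝ, 0 ≤ C ∧ ∀ τ, s₀ ≤ τ → |F.nH' τ| ≤ C * exp (-τ/2) := by
  refine ⟨3400 + 1800 * √(4 * (F.Pi s₀ * exp 1)), by positivity, fun τ hτ => ?_⟩
  have hR := h.regime_of_good hF hτ (h.good hF hτ)
  have h1 := hR.abs_nH'_le hF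
  have hP := F.Pi_pos τ
  have hP0 := F.Pi_pos s₀
  have h2 : ∀ θ, exp (-F.ρ τ θ) ≤ F.Pi s₀ * exp 1 / F.Pi τ := fun θ => by
    have h3 := (abs_le.1 (h.abs_ρ_sub_log_sub_le hF hτ θ)).1
    have e : F.Pi s₀ * exp 1 / F.Pi τ = exp (log (F.Pi s₀) + 1 - log (F.Pi τ)) := by
      rw [exp_sub, exp_add, exp_log hP, exp_log hP0]
    rw [e]
    exact exp_le_exp.2 (by linarith [h.ρ_nonneg θ])
  have h3 : ∫ θ in (0:ℝ)..1, exp (-F.ρ τ θ) ≤ F.Pi s₀ * exp 1 / F.Pi τ := by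
    have := integral_mono (μ := volume) zero_le_one (F.sρ.neg.exp.intervalIntegrable τ 0 1)
      (intervalIntegrable_const (c := F.Pi s₀ * exp 1 / F.Pi τ)) h2
    simpa using this
  have h4 : F.Pi s₀ * exp 1 / F.Pi τ ≤ 4 * (F.Pi s₀ * exp 1) * exp (-τ/4) ^ 2 := by
    rw [div_le_iff₀ hP, ← exp_half_eq]
    have h5 : 1 ≤ 4 * (F.Pi τ * exp (-τ/2)) := by have := hR.le_nPi; rw [nPi] at this; linarith
    have := mul_le_mul_of_nonneg_left h5 (by positivity : 0 ≤ F.Pi s₀ * exp 1)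
    linarith
  have h5 : √(∫ θ in (0:ℝ)..1, exp (-F.ρ τ θ)) ≤ √(4 * (F.Pi s₀ * exp 1)) * exp (-τ/4) := by
    refine (sqrt_le_sqrt (h3.trans h4)).trans_eq ?_
    rw [sqrt_mul (by positivity), sqrt_sq (exp_pos _).le]
  have h6 := mul_le_mul_of_nonneg_right h5 (exp_pos (-τ/4)).le
  rw [mul_assoc, ← sq, ← exp_half_eq] at h6
  linarith

theorem exists_nH_limit (hF : F.IsEinsteinFlow) (h : F.Initial s₀) :
    ∃ Cinf : ℝ, 0 < Cinf ∧ Cinf ≤ 3 ∧ ∃ C : ℝ, 0 ≤ C ∧ ∀ τ, s₀ ≤ τ →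
      |F.nH τ - Cinf ^ 2| ≤ C * exp (-τ/2) := by
  obtain ⟨C, hC, h1⟩ := h.exists_abs_nH'_le hF
  obtain ⟨L, hL⟩ := exists_limit_of_deriv_le_exp two_pos (fun t _ => hF.hasDerivAt_nH t) h1
  have h2 : 1/4 ≤ L := le_of_forall_le_add_exp (a := s₀) (C := C * 2) two_pos fun t ht => by
    have := (abs_le.1 (hL t ht)).2
    linarith [(h.good hF ht).le_nH]
  have h3 : -9 ≤ -L := le_of_forall_le_add_exp (a := s₀) (C := C * 2) two_pos fun t ht => by
    have := (abs_le.1 (hL t ht)).1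
    linarith [(h.good hF ht).nH_le]
  refine ⟨√L, sqrt_pos.2 (by linarith), ?_, C * 2, by positivity, fun τ hτ => ?_⟩
  · rw [sqrt_le_left (by norm_num)]; linarith
  · rw [sq_sqrt (by linarith)]; exact hL τ hτ

theorem exists_err_le (hF : F.IsEinsteinFlow) (h : F.Initial s₀) :
    ∃ C : ℝ, 0 ≤ C ∧ ∀ τ, s₀ ≤ τ → |F.errc τ| + |F.errd τ| ≤ C * exp (-τ/2) := by
  obtain ⟨C, hC, h1⟩ := h.exists_abs_nH'_le hF
  refine ⟨2 * C + 14000, by positivity, fun τ hτ => ?_⟩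
  have hg := h.good hF hτ
  have := hg.err_le hF (h.regime_of_good hF hτ hg)
  linarith [h1 τ hτ]

theorem exists_sqrt_lyap_le_weak (hF : F.IsEinsteinFlow) (h : F.Initial s₀) :
    ∃ C : ℝ, 0 ≤ C ∧ ∀ τ, s₀ ≤ τ → √(F.lyap τ) ≤ C * exp (-τ/16) := by
  obtain ⟨C, hC, herr⟩ := h.exists_err_le hF
  set K := F.lyap s₀ * exp (s₀/8) + 200 * C^2 * (8/7) * exp (-s₀/(8/7)) with hK
  have hK0 : 0 ≤ K := by have := F.lyap_nonneg s₀; positivity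
  refine ⟨√K, sqrt_nonneg _, fun τ hτ => ?_⟩
  have hd : ∀ u : ℝ, HasDerivAt (fun s : ℝ => exp (s/8)) (exp (u/8) * (1/8)) u := fun u =>
    ((hasDerivAt_id u).div_const 8).exp
  have h1 := le_of_hasDerivAt_nonpos hτ
    (fun u hu => ((hF.hasDerivAt_lyap (h.good hF hu.1).nH_pos).mul (hd u)).add
      ((hasDerivAt_exp_neg_div (8/7) u).const_mul (200 * C^2 * (8/7)))) (fun u hu => by
        have h2 := (h.good hF hu.1).lyap'_le_sq
        have h3 : (|F.errc u| + |F.errd u|) ^ 2 ≤ (C * exp (-u/2)) ^ 2 := by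
          gcongr; exact herr u hu.1
        have h4 : F.lyap' u + F.lyap u / 8 ≤ 200 * (C * exp (-u/2)) ^ 2 := by linarith
        have h5 := mul_le_mul_of_nonneg_right h4 (exp_pos (u/8)).le
        have e : exp (-u/(8/7)) = exp (-u/2) ^ 2 * exp (u/8) := by
          rw [← exp_nat_mul, ← exp_add]; congr 1; push_cast; ring
        rw [e]
        linarith)
  simp only [Pi.add_apply, Pi.mul_apply] at h1
  rw [← hK] at h1
  have h2 : F.lyap τ * exp (τ/8) ≤ K := by
    have : 0 ≤ 200 * C^2 * (8/7) * exp (-τ/(8/7)) := by positivity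
    linarith
  have h3 : F.lyap τ ≤ K * exp (-τ/16) ^ 2 := by
    have e : exp (τ/8) * exp (-τ/16) ^ 2 = 1 := by
      rw [← exp_nat_mul, ← exp_add, exp_eq_one_iff]; push_cast; ring
    have := mul_le_mul_of_nonneg_right h2 (sq_nonneg (exp (-τ/16)))
    rwa [mul_assoc, e, mul_one] at this
  refine (sqrt_le_sqrt h3).trans_eq ?_
  rw [sqrt_mul hK0, sqrt_sq (exp_pos _).le]

theorem exists_sqrt_lyap_le (hF : F.IsEinsteinFlow) (h : F.Initial s₀) :
    ∃ C : ℝ, 0 ≤ C ∧ ∀ τ, s₀ ≤ τ → √(F.lyap τ) ≤ C * exp (-τ/4) := by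
  obtain ⟨C, hC, herr⟩ := h.exists_err_le hF
  obtain ⟨K, hK, hweak⟩ := h.exists_sqrt_lyap_le_weak hF
  set k := 40 * K + 3 + 3 * C^2 with hk
  have hk0 : 0 ≤ k := by positivity
  set Z := (F.lyap s₀ * exp (s₀/2) + 1) * exp (k * 16 * exp (-s₀/16)) with hZ
  have hZ0 : 0 ≤ Z := by have := F.lyap_nonneg s₀; positivity
  refine ⟨√Z, sqrt_nonneg _, fun τ hτ => ?_⟩
  have hd : ∀ u : ℝ, HasDerivAt (fun s : ℝ => exp (s/2)) (exp (u/2) * (1/2)) u := fun u =>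
    ((hasDerivAt_id u).div_const 2).exp
  have h1 := le_of_hasDerivAt_nonpos hτ
    (fun u hu => (((hF.hasDerivAt_lyap (h.good hF hu.1).nH_pos).mul (hd u)).add_const 1).mul
      ((hasDerivAt_exp_neg_div 16 u).const_mul (k * 16)).exp) (fun u hu => by
        have h2 := (h.good hF hu.1).lyap'_le
        have h3 := herr u hu.1
        have h4 := hweak u hu.1
        have hq := F.lyap_nonneg u
        have hs := sq_sqrt hq
        have hs0 := sqrt_nonneg (F.lyap u)
        have hb := exp_pos (-u/16)
        have hE := exp_pos (u/2)
        have e1 : exp (-u/2) = exp (-u/16) ^ 8 := by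
          rw [← exp_nat_mul]; congr 1; push_cast; ring
        have e2 : exp (u/2) * exp (-u/16) ^ 8 = 1 := by
          rw [← exp_nat_mul, ← exp_add, exp_eq_one_iff]; push_cast; ring
        have hb1 : exp (-u/16) ≤ 1 := by
          rw [exp_le_one_iff]; linarith [h.pos, hu.1]
        set b := exp (-u/16)
        set s := √(F.lyap u)
        rw [e1] at h3
        have m1 : 40 * s * F.lyap u ≤ 40 * (K * b) * F.lyap u := by gcongr
        have m2 : 6 * s * (|F.errc u| + |F.errd u|) ≤ 6 * s * (C * b^8) := by gcongr
        have m3 : 6 * s * (C * b^8) ≤ 3 * b * F.lyap u + 3 * C^2 * (b^8 * b) := by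
          have m4 : b^8 * b^7 ≤ b^8 * b := by
            have : b^7 ≤ b := pow_le_of_le_one hb.le hb1 (by norm_num)
            gcongr
          have m5 : 0 ≤ 3 * b * (s - C * b^7)^2 := by positivity
          have m6 := mul_le_mul_of_nonneg_left m4 (by positivity : 0 ≤ 3 * C^2)
          rw [← hs]; linarith
        have m7 : F.lyap' u + F.lyap u * (1/2)
            ≤ (40 * K + 3) * b * F.lyap u + 3 * C^2 * (b^8 * b) := by linarith
        have m8 := mul_le_mul_of_nonneg_right m7 hE.le
        have m9 : (40 * K + 3) * b * (F.lyap u * exp (u/2)) + 3 * C^2 * b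
            ≤ k * b * (F.lyap u * exp (u/2) + 1) := by
          have n1 : 0 ≤ 3 * C^2 * (b * (F.lyap u * exp (u/2))) := by positivity
          have n2 : 0 ≤ (40 * K + 3) * b := by positivity
          rw [hk]; linarith
        have m10 : (F.lyap' u + F.lyap u * (1/2)) * exp (u/2)
            ≤ k * b * (F.lyap u * exp (u/2) + 1) := by
          have : 3 * C^2 * (b^8 * b) * exp (u/2) = 3 * C^2 * b := by
            linear_combination 3 * C^2 * b * e2
          linarith
        have m11 := mul_le_mul_of_nonneg_right m10 (exp_pos (k * 16 * b)).le
        simp only [Pi.mul_apply]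
        linarith)
  simp only [Pi.mul_apply] at h1
  rw [← hZ] at h1
  have h2 : F.lyap τ * exp (τ/2) ≤ Z := by
    have h3 : 1 ≤ exp (k * 16 * exp (-τ/16)) := one_le_exp (by positivity)
    have h4 : 0 ≤ F.lyap τ * exp (τ/2) + 1 := by have := F.lyap_nonneg τ; positivity
    have := mul_le_mul_of_nonneg_left h3 h4
    linarith
  have h3 : F.lyap τ ≤ Z * exp (-τ/4) ^ 2 := by
    have e : exp (τ/2) * exp (-τ/4) ^ 2 = 1 := by
      rw [← exp_nat_mul, ← exp_add, exp_eq_one_iff]; push_cast; ring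
    have := mul_le_mul_of_nonneg_right h2 (sq_nonneg (exp (-τ/4)))
    rwa [mul_assoc, e, mul_one] at this
  refine (sqrt_le_sqrt h3).trans_eq ?_
  rw [sqrt_mul hZ0, sqrt_sq (exp_pos _).le]

end Initial

end T2Flow

namespace T2Flow

namespace Good

variable {F : T2Flow} {τ K C : ℝ}

theorem abs_c_le (hK : √(F.lyap τ) ≤ K * exp (-τ/4)) : |F.c τ| ≤ 2 * K * exp (-τ/4) := by
  have := (lyapunov_bounds (c := F.c τ) (d := F.d τ)).2.1
  change _ ≤ 13/20 * √(F.lyap τ) at this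
  linarith [sqrt_nonneg (F.lyap τ)]

theorem abs_d_le (hK : √(F.lyap τ) ≤ K * exp (-τ/4)) : |F.d τ| ≤ 2 * K * exp (-τ/4) := by
  have := (lyapunov_bounds (c := F.c τ) (d := F.d τ)).2.2
  change _ ≤ 6/5 * √(F.lyap τ) at this
  linarith [sqrt_nonneg (F.lyap τ)]

theorem sqrt_sq_add_sq_le (a b : ℝ) : √(a ^ 2 + b ^ 2) ≤ |a| + |b| := by
  rw [sqrt_le_left (by positivity), ← sq_abs a, ← sq_abs b]
  nlinarith [abs_nonneg a, abs_nonneg b]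

theorem abs_sqrt_nH_sub_le (h : F.Good τ) {a : ℝ} (ha : 0 < a)
    (hL : |F.nH τ - a ^ 2| ≤ C) : |√(F.nH τ) - a| ≤ 2 * C := by
  have hs := h.sqrt_bounds.1
  have e : F.nH τ - a ^ 2 = (√(F.nH τ) - a) * (√(F.nH τ) + a) := by
    rw [← sq_sqrt h.nH_pos.le]
    simp only [sqrt_sq (sqrt_nonneg _)]
    ring
  rw [e, abs_mul, abs_of_pos (by positivity : 0 < √(F.nH τ) + a)] at hL
  have := mul_le_mul_of_nonneg_left (by linarith : 1/2 ≤ √(F.nH τ) + a)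
    (abs_nonneg (√(F.nH τ) - a))
  linarith

theorem abs_nPi_sub_le (h : F.Good τ) {a : ℝ} (hL : |√(F.nH τ) - a| ≤ C) :
    |F.nPi τ - 2 * (1 / √10) * a| ≤ 3 * |F.c τ| + C := by
  obtain ⟨r1, r2, -⟩ := inv_sqrt_ten_bounds
  have e : F.nPi τ - 2 * (1 / √10) * a
      = F.c τ * √(F.nH τ) + 2 * (1 / √10) * (√(F.nH τ) - a) := by rw [h.nPi_eq]; ring
  rw [e]
  refine (abs_add_le _ _).trans ?_
  rw [abs_mul, abs_mul, abs_of_nonneg (sqrt_nonneg _),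
    abs_of_pos (by linarith : 0 < 2 * (1 / √10))]
  nlinarith [abs_nonneg (F.c τ), h.sqrt_bounds.2, abs_nonneg (√(F.nH τ) - a)]

theorem abs_nY_sub_le (h : F.Good τ) {a : ℝ} (hL : |√(F.nH τ) - a| ≤ C) :
    |F.nY τ - 1 / √10 * a| ≤ 3 * |F.d τ| + C := by
  obtain ⟨r1, r2, -⟩ := inv_sqrt_ten_bounds
  have e : F.nY τ - 1 / √10 * a
      = F.d τ * √(F.nH τ) + 1 / √10 * (√(F.nH τ) - a) := by rw [h.nY_eq]; ring
  rw [e]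
  refine (abs_add_le _ _).trans ?_
  rw [abs_mul, abs_mul, abs_of_nonneg (sqrt_nonneg _), abs_of_pos (by linarith : 0 < 1 / √10)]
  nlinarith [abs_nonneg (F.d τ), h.sqrt_bounds.2, abs_nonneg (√(F.nH τ) - a)]

theorem abs_nE_div_sub_le (h : F.Good τ) (hR : F.Regime τ) {a : ℝ} (ha : 0 < a) (ha3 : a ≤ 3)
    (hL : |√(F.nH τ) - a| ≤ C) :
    |F.nE τ / F.nPi τ - √10 / 2 * a| ≤ 800 * exp (-τ/2) + 2 * C + 8 * |F.c τ| := by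
  obtain ⟨r1, r2, r3⟩ := inv_sqrt_ten_bounds
  obtain ⟨⟨x1, x2⟩, -, -⟩ := h.bounds
  have hP := F.nPi_pos τ
  have hs := h.sqrt_bounds
  have hW := hR.abs_nH_sub_nE_le
  have hr : √10 / 2 = 1 / (2 * (1 / √10)) := by field_simp
  have hx : F.c τ + 2 * (1 / √10) ≠ 0 := by linarith
  have hs0 : √(F.nH τ) ≠ 0 := by linarith
  have hr0 : 2 * (1 / √10) ≠ 0 := by linarith
  have e : F.nE τ / F.nPi τ - √10 / 2 * a = -(F.nH τ - F.nE τ) / F.nPi τ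
      + (2 * (1 / √10) * (√(F.nH τ) - a) - F.c τ * a)
        / (2 * (1 / √10) * (F.c τ + 2 * (1 / √10))) := by
    have h1 : F.nH τ / F.nPi τ = √(F.nH τ) / (F.c τ + 2 * (1 / √10)) := by
      rw [h.nPi_eq]
      nth_rewrite 1 [← sq_sqrt h.nH_pos.le]
      rw [sq, mul_div_mul_right _ _ hs0]
    have h2 : -(F.nH τ - F.nE τ) / F.nPi τ = F.nE τ / F.nPi τ - F.nH τ / F.nPi τ := by ring
    rw [h2, h1, hr]
    generalize 1 / √10 = r at *
    have : 2 * r ≠ 0 := hr0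
    have : r ≠ 0 := by linarith
    field_simp
    ring
  rw [e]
  have b1 : |-(F.nH τ - F.nE τ) / F.nPi τ| ≤ 800 * exp (-τ/2) := by
    rw [abs_div, abs_neg, abs_of_pos hP, div_le_iff₀ hP]
    nlinarith [hR.le_nPi, exp_pos (-τ/2)]
  have b2 : |(2 * (1 / √10) * (√(F.nH τ) - a) - F.c τ * a)
        / (2 * (1 / √10) * (F.c τ + 2 * (1 / √10)))| ≤ 2 * C + 8 * |F.c τ| := by
    have hden : 39/100 ≤ 2 * (1 / √10) * (F.c τ + 2 * (1 / √10)) := by nlinarith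
    rw [abs_div, abs_of_pos (by linarith : 0 < 2 * (1 / √10) * (F.c τ + 2 * (1 / √10))),
      div_le_iff₀ (by linarith)]
    have b3 := abs_sub (2 * (1 / √10) * (√(F.nH τ) - a)) (F.c τ * a)
    rw [abs_mul (2 * (1 / √10)), abs_mul (F.c τ), abs_of_pos ha,
      abs_of_pos (by linarith : 0 < 2 * (1 / √10))] at b3
    have b4 : 2 * (1 / √10) * |√(F.nH τ) - a| ≤ 634/1000 * C := by gcongr; linarith
    have b5 : |F.c τ| * a ≤ |F.c τ| * 3 := by gcongr
    have b6 := mul_le_mul_of_nonneg_left hden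
      (by have := (abs_nonneg _).trans hL; positivity : 0 ≤ 2 * C + 8 * |F.c τ|)
    have := (abs_nonneg _).trans hL
    linarith [abs_nonneg (F.c τ)]
  linarith [abs_add_le (-(F.nH τ - F.nE τ) / F.nPi τ) ((2 * (1 / √10) * (√(F.nH τ) - a)
    - F.c τ * a) / (2 * (1 / √10) * (F.c τ + 2 * (1 / √10))))]

theorem abs_rate_sub_le (h : F.Good τ) : |F.rate τ - 1/2| ≤ 2 * (|F.c τ| + |F.d τ|) := by
  obtain ⟨⟨x1, x2⟩, -, -⟩ := h.bounds
  have hx : F.c τ + 2 * (1 / √10) ≠ 0 := by linarith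
  have e : F.rate τ - 1/2 = (F.d τ - F.c τ/2) / (F.c τ + 2 * (1 / √10)) := by
    rw [h.rate_eq, div_sub_div _ _ hx two_ne_zero, div_eq_div_iff (by simpa using hx) hx]
    ring
  rw [e, abs_div, abs_of_pos (by linarith : 0 < F.c τ + 2 * (1 / √10)), div_le_iff₀ (by linarith)]
  have h1 := abs_sub (F.d τ) (F.c τ/2)
  rw [abs_div, abs_two] at h1
  have := mul_le_mul_of_nonneg_left x1.le
    (by positivity : 0 ≤ 2 * (|F.c τ| + |F.d τ|))
  linarith [abs_nonneg (F.c τ), abs_nonneg (F.d τ)]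

end Good

variable {F : T2Flow} {s₀ : ℝ}

theorem exp_mul_E_eq_nE_div (F : T2Flow) (τ : ℝ) :
    exp (3*τ/2) * F.E τ = F.nE τ / F.nPi τ := by
  have e : exp (3*τ/2) = (exp (-τ/2) ^ 3)⁻¹ := by
    rw [← exp_nat_mul, ← exp_neg]; congr 1; push_cast; ring
  have := exp_pos (-τ/2)
  rw [Regime.E_eq, e]
  field_simp

theorem Initial.asymptotics (hF : F.IsEinsteinFlow) (h : F.Initial s₀) :
    ∃ Cinf : ℝ, 0 < Cinf ∧ ∃ ρinf : ℝ → ℝ, ∃ C : ℝ, 0 < C ∧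
      ∀ τ : ℝ, s₀ ≤ τ →
        √(F.c τ ^ 2 + F.d τ ^ 2) ≤ C * exp (-τ/4) ∧
        |exp τ * F.H τ - Cinf ^ 2| ≤ C * exp (-τ/4) ∧
        |exp (-τ/2) * F.Pi τ - (2 / √10) * Cinf| ≤ C * exp (-τ/4) ∧
        |exp (-5*τ/2) * F.Y τ - (1 / √10) * Cinf| ≤ C * exp (-τ/4) ∧
        |exp (3*τ/2) * F.E τ - (√10 / 2) * Cinf| ≤ C * exp (-τ/4) ∧
        (∀ θ : ℝ, |circleMean (F.l τ) - F.l τ θ| ≤ C * exp (-τ/2)) ∧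
        (∀ θ : ℝ, |exp (F.l τ θ) - 1/2| ≤ C * exp (-τ/4)) ∧
        (∀ θ : ℝ, |circleMean (F.V τ) - F.V τ θ|
            + |exp (F.V τ θ - τ) * (circleMean (F.Q τ) - F.Q τ θ)| ≤ C * exp (-τ/2)) ∧
        (∀ θ : ℝ, |(F.Pi τ)⁻¹ * exp (F.ρ τ θ) - exp (ρinf θ)| ≤ C * exp (-τ/2)) := by
  obtain ⟨ρinf, C₁, hC₁, hρ⟩ := h.exists_ρ_limit hF
  obtain ⟨Cinf, hpos, hle, C₂, hC₂, hH⟩ := h.exists_nH_limit hF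
  obtain ⟨K, hK, hlyap⟩ := h.exists_sqrt_lyap_le hF
  refine ⟨Cinf, hpos, ρinf, C₁ + 4 * C₂ + 16 * K + 1000, by positivity, fun τ hτ => ?_⟩
  have hg := h.good hF hτ
  have hR := h.regime_of_good hF hτ hg
  have hs := hg.abs_sqrt_nH_sub_le hpos (hH τ hτ)
  have hc := Good.abs_c_le (hlyap τ hτ)
  have hd := Good.abs_d_le (hlyap τ hτ)
  have ha := exp_pos (-τ/4)
  have hb := exp_pos (-τ/2)
  have hba : exp (-τ/2) ≤ exp (-τ/4) := exp_le_exp.2 (by linarith [h.pos])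
  have q1 := mul_le_mul_of_nonneg_left hba hC₂
  have p1 := mul_nonneg hC₁ ha.le
  have p2 := mul_nonneg hC₂ ha.le
  have p3 := mul_nonneg hK ha.le
  have p4 := mul_nonneg hC₁ hb.le
  have p5 := mul_nonneg hC₂ hb.le
  have p6 := mul_nonneg hK hb.le
  refine ⟨?_, ?_, ?_, ?_, ?_, fun θ => ?_, fun θ => ?_, fun θ => ?_, fun θ => ?_⟩
  · refine (Good.sqrt_sq_add_sq_le _ _).trans ?_
    linarith
  · have := hH τ hτ
    rw [nH] at this
    linarith
  · have := hg.abs_nPi_sub_le hs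
    rw [nPi, mul_comm (F.Pi τ), mul_one_div] at this
    linarith
  · have := hg.abs_nY_sub_le hs
    rw [nY, mul_comm (F.Y τ)] at this
    linarith
  · have := hg.abs_nE_div_sub_le hR hpos hle hs
    rw [exp_mul_E_eq_nE_div]
    linarith
  · rw [abs_sub_comm]
    have := (hF.abs_l_sub_mean_le τ θ).trans hR.exp_mul_E_le
    linarith
  · have h1 := hR.abs_exp_l_sub_rate_le hF θ
    have h2 := hg.abs_rate_sub_le
    have h3 := abs_add_le (exp (F.l τ θ) - F.rate τ) (F.rate τ - 1/2)
    rw [sub_add_sub_cancel] at h3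
    linarith
  · have h1 := (F.abs_V_sub_mean_le τ θ).trans hR.osc_le
    have h2 := F.Q_sub_mean_le τ θ
    have h3 := mul_le_mul hR.exp_osc_le hR.osc_le (F.osc_nonneg τ) (by norm_num)
    rw [abs_sub_comm] at h1
    rw [abs_mul, abs_of_pos (exp_pos _), abs_sub_comm (circleMean (F.Q τ))]
    linarith
  · have := hρ τ hτ θ
    linarith

/-- The hypotheses at the initial time in terms of the small parameter. -/
theorem Initial.of_small {ε : ℝ} (h0 : 0 ≤ ε) (hε : ε ≤ 1/10^41) (hB : ∀ τ, F.B τ = 0)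
    (hA : |F.A s₀| < 1) (hρ : 0 < ⨅ θ : ℝ, F.ρ s₀ θ) (hc : |F.c s₀| < ε) (hd : |F.d s₀| < ε)
    (hE : |F.Pi s₀ * F.E s₀ / F.H s₀ - 1| < 1) (h1 : (1/2) * ε⁻¹ < exp s₀)
    (h2 : exp s₀ < 2 * ε⁻¹) (h3 : exp s₀ * F.H s₀ + 1 * √ε < 2 * ε * exp s₀)
    (h4 : 1 / 2 < exp s₀ * F.H s₀ - 1 * √ε) : F.Initial s₀ := by
  have hε0 : 0 < ε := by
    rcases h0.lt_or_eq with h | h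
    · exact h
    · rw [← h] at h2; simp only [inv_zero, mul_zero] at h2; exact absurd h2 (exp_pos _).not_gt
  have hsε := sqrt_nonneg ε
  have hG1 : 1/2 ≤ F.nH s₀ := by rw [nH]; linarith
  have hHpos : 0 < F.H s₀ := pos_of_mul_pos_right (by linarith : 0 < exp s₀ * F.H s₀) (exp_pos _).le
  have hεe : ε * exp s₀ ≤ 2 := by
    have := mul_le_mul_of_nonneg_left h2.le hε0.le
    rwa [mul_left_comm, mul_inv_cancel₀ hε0.ne', mul_one] at this
  refine ⟨hB, hA.le, fun θ => ?_, ?_, hG1, ?_, ?_, ?_⟩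
  · by_cases hb : BddBelow (Set.range fun θ => F.ρ s₀ θ)
    · exact (hρ.le).trans (ciInf_le hb θ)
    · rw [Real.iInf_of_not_bddBelow hb] at hρ
      exact absurd hρ (lt_irrefl _)
  · have e1 : exp (-s₀/4) ^ 4 = (exp s₀)⁻¹ := by
      rw [← exp_nat_mul, ← exp_neg]; congr 1; push_cast; ring
    have e2 : (exp s₀)⁻¹ ≤ 2 * ε := by
      rw [inv_le_comm₀ (exp_pos _) (by positivity), mul_inv]
      linarith
    refine le_of_pow_le_pow_left₀ (n := 4) (by norm_num) (by norm_num) ?_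
    rw [e1]
    refine e2.trans ((mul_le_mul_of_nonneg_left hε two_pos.le).trans (by norm_num))
  · rw [nH]; linarith
  · have h5 := (abs_lt.1 hE).2
    have h6 : F.Pi s₀ * F.E s₀ / F.H s₀ < 2 := by linarith
    rw [div_lt_iff₀ hHpos] at h6
    rw [nE, nH]
    nlinarith [exp_pos s₀]
  · have hc2 : F.c s₀ ^ 2 ≤ ε ^ 2 := by rw [← sq_abs]; gcongr
    have hd2 : F.d s₀ ^ 2 ≤ ε ^ 2 := by rw [← sq_abs]; gcongr
    have hε2 : ε ^ 2 ≤ (1/10^41) ^ 2 := by gcongr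
    rw [lyap, lyapunov]
    nlinarith [sq_nonneg (F.d s₀ + F.c s₀ / 4)]

end T2Flow

/-- The main theorem: for sufficiently small `ε`, any `B₀` T²-symmetric Einstein
flow satisfying the smallness conditions at time `s₀ > 0` has the asymptotics of
the polarised attractor. -/
theorem main_theorem :
    ∃ ε₀ C₁ M : ℝ, 0 < ε₀ ∧ 0 < C₁ ∧ 1 < M ∧
      ∀ ε : ℝ, 0 ≤ ε → ε ≤ ε₀ →
      ∀ (F : T2Flow), F.IsEinsteinFlow → (∀ τ : ℝ, F.B τ = 0) →
      ∀ s₀ : ℝ, 0 < s₀ →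
        |F.A s₀| < 1 →
        0 < (⨅ θ : ℝ, F.ρ s₀ θ) →
        |F.c s₀| < ε →
        |F.d s₀| < ε →
        |F.Pi s₀ * F.E s₀ / F.H s₀ - 1| < 1 →
        (1/2) * ε⁻¹ < Real.exp s₀ →
        Real.exp s₀ < 2 * ε⁻¹ →
        Real.exp s₀ * F.H s₀ + C₁ * Real.sqrt ε < M * ε * Real.exp s₀ →
        0 < 1 / M →
        1 / M < Real.exp s₀ * F.H s₀ - C₁ * Real.sqrt ε →
        ∃ Cinf : ℝ, 0 < Cinf ∧ ∃ ρinf : ℝ → ℝ, ∃ C : ℝ, 0 < C ∧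
          ∀ τ : ℝ, s₀ ≤ τ →
            Real.sqrt (F.c τ ^ 2 + F.d τ ^ 2) ≤ C * Real.exp (-τ/4) ∧
            |Real.exp τ * F.H τ - Cinf ^ 2| ≤ C * Real.exp (-τ/4) ∧
            |Real.exp (-τ/2) * F.Pi τ - (2 / Real.sqrt 10) * Cinf|
              ≤ C * Real.exp (-τ/4) ∧
            |Real.exp (-5*τ/2) * F.Y τ - (1 / Real.sqrt 10) * Cinf|
              ≤ C * Real.exp (-τ/4) ∧
            |Real.exp (3*τ/2) * F.E τ - (Real.sqrt 10 / 2) * Cinf|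
              ≤ C * Real.exp (-τ/4) ∧
            (∀ θ : ℝ, |circleMean (F.l τ) - F.l τ θ| ≤ C * Real.exp (-τ/2)) ∧
            (∀ θ : ℝ, |Real.exp (F.l τ θ) - 1/2| ≤ C * Real.exp (-τ/4)) ∧
            (∀ θ : ℝ, |circleMean (F.V τ) - F.V τ θ|
                + |Real.exp (F.V τ θ - τ) * (circleMean (F.Q τ) - F.Q τ θ)|
              ≤ C * Real.exp (-τ/2)) ∧
            (∀ θ : ℝ, |(F.Pi τ)⁻¹ * Real.exp (F.ρ τ θ) - Real.exp (ρinf θ)|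
              ≤ C * Real.exp (-τ/2)) := by
  refine ⟨1/10^41, 1, 2, by norm_num, one_pos, by norm_num, ?_⟩
  intro ε h0 hε F hF hB s₀ _ hA hρ hc hd hE h1 h2 h3 _ h4
  exact (T2Flow.Initial.of_small h0 hε hB hA hρ hc hd hE h1 h2 h3 h4).asymptotics hF
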